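/- arXiv:1807.00600 — 6 statements merged into one kernel-verified Lean document; each statement's English description precedes it below -/
import Mathlib

section
/- Let D = (V,A) be an acyclic digraph with a fixed linear order on V, (σ,≪) a heavy arc signature of D, and w a (σ,≪)-weighting of D; let μ be the path matrix μ(u,v) = Σ_{p path from u to v} ∏_{a∈|p|_A} w(a). Let S, T₀ ⊆ V be equicardinal sets such that there exists a linking from S onto T₀ in D, and let R be the ≪≪-maximal routing from S to T₀ in D. Then sgn(det(μ|S×T₀)) = sgn_σ(R). -/
/-- A walk in the digraph with arc set `A`: a nonempty list of vertices,
each consecutive pair of which is an arc. -/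
def IsWalk {V : Type*} (A : Set (V × V)) (p : List V) : Prop :=
  p ≠ [] ∧ p.Chain' (fun u v => (u, v) ∈ A)

/-- A path: a walk with pairwise distinct vertices. -/
def IsPath {V : Type*} (A : Set (V × V)) (p : List V) : Prop :=
  IsWalk A p ∧ p.Nodup

/-- The set of arcs traversed by a walk. -/
def pathArcs {V : Type*} (p : List V) : Set (V × V) :=
  {a | a ∈ p.zip p.tail}

/-- A cycle: a walk `c₁…c_n` with `n > 1`, `c₁ = c_n`, and `c₁…c_{n-1}` a path. -/
def IsCycle {V : Type*} (A : Set (V × V)) (p : List V) : Prop :=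
  IsWalk A p ∧ 1 < p.length ∧ p.head? = p.getLast? ∧ IsPath A p.dropLast

/-- A routing from `X` to `Y`: a set of pairwise vertex-disjoint paths such that
every `x ∈ X` is the first vertex of some path and every path ends in `Y`. -/
def IsRouting {V : Type*} (A : Set (V × V)) (R : Set (List V)) (X Y : Set V) : Prop :=
  (∀ p ∈ R, IsPath A p) ∧
  (∀ x ∈ X, ∃ p ∈ R, p.head? = some x) ∧
  (∀ p ∈ R, ∃ y ∈ Y, p.getLast? = some y) ∧
  (∀ p ∈ R, ∀ q ∈ R, p = q ∨ ∀ v, v ∈ p → v ∉ q)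

/-- There is a routing from `X` to `Y` in the digraph with arcs `A`. -/
def HasRouting {V : Type*} (A : Set (V × V)) (X Y : Set V) : Prop :=
  ∃ R, IsRouting A R X Y

/-- A linking from `X` onto `Y`: a routing whose set of path endpoints is exactly `Y`. -/
def IsLinking {V : Type*} (A : Set (V × V)) (R : Set (List V)) (X Y : Set V) : Prop :=
  IsRouting A R X Y ∧ {y | ∃ p ∈ R, p.getLast? = some y} = Y

/-- Independence in the gammoid `Γ(D,T,E)`. -/
def GammoidIndep {V : Type*} (A : Set (V × V)) (T E : Set V) (X : Set V) : Prop :=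
  X ⊆ E ∧ HasRouting A X T

/-- Circuits of the gammoid `Γ(D,T,E)`: minimal dependent subsets of `E`. -/
def GammoidCircuit {V : Type*} (A : Set (V × V)) (T E : Set V) (C : Set V) : Prop :=
  C ⊆ E ∧ ¬HasRouting A C T ∧ ∀ C', C' ⊂ C → HasRouting A C' T

/-- Independence in the contraction `M/C` of a matroid given by its independence
predicate: `X` is independent iff `X ∪ I` is independent for some maximal
independent subset `I` of `C`. -/
def ContractIndep {α : Type*} (Indep : Set α → Prop) (C : Set α) (X : Set α) : Prop :=
  ∃ I, I ⊆ C ∧ Indep I ∧ (∀ J, I ⊆ J → J ⊆ C → Indep J → J = I) ∧ Indep (X ∪ I)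

/-- An indeterminate weighting: an injective map on arcs whose values cannot be expressed
as integer polynomial expressions (`a₀ + a₁·x₁₁⋯x₁ₙ + …`) in the remaining values. -/
def IsIndetWeighting {V : Type*} (A : Set (V × V)) (w : V × V → ℝ) : Prop :=
  Set.InjOn w A ∧ ∀ a ∈ A, w a ∉ Subring.closure (w '' A \ {w a})

/-- The product of the weights of the arcs traversed by a walk. -/
def pathProd {V : Type*} (w : V × V → ℝ) (p : List V) : ℝ :=
  ((p.zip p.tail).map w).prod

/-- The path matrix: `μ(u,v)` is the sum over all paths from `u` to `v`
of the product of the arc weights. -/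
noncomputable def pathMatrix {V : Type*} (A : Set (V × V)) (w : V × V → ℝ) (u v : V) : ℝ :=
  ∑ᶠ p ∈ {p : List V | IsPath A p ∧ p.head? = some u ∧ p.getLast? = some v}, pathProd w p

/-- `r` is a linear order on the elements of `A`. -/
def IsLinearOrderOn {β : Type*} (A : Set β) (r : β → β → Prop) : Prop :=
  (∀ a ∈ A, r a a) ∧ (∀ a ∈ A, ∀ b ∈ A, r a b → r b a → a = b) ∧
  (∀ a ∈ A, ∀ b ∈ A, ∀ c ∈ A, r a b → r b c → r a c) ∧
  (∀ a ∈ A, ∀ b ∈ A, r a b ∨ r b a)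

/-- The set of arcs traversed by a routing. -/
def routingArcs {V : Type*} (R : Set (List V)) : Set (V × V) :=
  ⋃ p ∈ R, pathArcs p

/-- The `(σ,≪)`-induced routing order: `Q ≪≪ R` iff the `≪`-maximal element of the
symmetric difference `Q_A △ R_A` lies in `R_A`. -/
def RoutingLT {V : Type*} (r : V × V → V × V → Prop) (Q R : Set (List V)) : Prop :=
  ∃ a ∈ routingArcs R, a ∈ symmDiff (routingArcs Q) (routingArcs R) ∧
    ∀ b ∈ symmDiff (routingArcs Q) (routingArcs R), r b a

/-- `R` is the `≪≪`-maximal routing from `X` to `Y`. -/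
def IsMaxRouting {V : Type*} (r : V × V → V × V → Prop) (A : Set (V × V))
    (R : Set (List V)) (X Y : Set V) : Prop :=
  IsRouting A R X Y ∧ ∀ Q, IsRouting A Q X Y → Q ≠ R → RoutingLT r Q R

/-- A `(σ,≪)`-weighting: an indeterminate weighting with `|w(a)| ≥ 1`,
`sgn(w(a)) = σ(a)`, and `Σ_{L ⊆ {x ≪ a, x ≠ a}} Π_{x∈L} |w(x)| < |w(a)|` for all arcs. -/
def IsHeavyWeighting {V : Type*} (A : Set (V × V)) (σ : V × V → ℝ)
    (r : V × V → V × V → Prop) (w : V × V → ℝ) : Prop :=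
  IsIndetWeighting A w ∧ ∀ a ∈ A,
    1 ≤ |w a| ∧ Real.sign (w a) = σ a ∧
    (∑ᶠ L ∈ {L : Set (V × V) | L ⊆ {x ∈ A | r x a ∧ x ≠ a}}, ∏ᶠ x ∈ L, |w x|) < |w a|

/-- The arc set of the lifting `D^{(c)}_{(x,t)}` of a cycle `c = u v …` in `D`. -/
def liftArcs {V : Type*} (A : Set (V × V)) (u v x t : V) : Set (V × V) :=
  (A \ {(u, v)}) ∪ {(u, t), (x, v), (x, t)}

/-! ### Heavy weights dominate lexicographically smaller products -/

/-- A nonempty finite set linearly ordered by `r` has a largest element. -/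
theorem exists_greatest_of_isLinearOrderOn {α : Type*} {A : Set α} {r : α → α → Prop}
    (hr : IsLinearOrderOn A r) (U : Finset α) (hU : ↑U ⊆ A) (hne : U.Nonempty) :
    ∃ a ∈ U, ∀ b ∈ U, r b a := by
  obtain ⟨hrefl, -, htrans, htotal⟩ := hr
  classical
  induction hne using Finset.Nonempty.cons_induction with
  | singleton a => exact ⟨a, by simp, by simpa using hrefl a (hU (by simp))⟩
  | cons a s ha hs ih =>
    obtain ⟨m, hm, hmax⟩ := ih fun x hx => hU (by simp_all)
    have haA : a ∈ A := hU (by simp)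
    have hmA : m ∈ A := hU (by simp [hm])
    rcases htotal a haA m hmA with h | h
    · refine ⟨m, by simp [hm], fun b hb => ?_⟩
      rcases Finset.mem_cons.1 hb with rfl | hb
      exacts [h, hmax b hb]
    · refine ⟨a, by simp, fun b hb => ?_⟩
      rcases Finset.mem_cons.1 hb with rfl | hb
      exacts [hrefl _ haA, htrans b (hU (by simp [hb])) m hmA a haA (hmax b hb) h]

open Classical in
/-- If every weight exceeds the sum of all products of smaller weights, then the product over a
finite set `R` exceeds, by at least one, the sum of the products over all sets `L ⊈ R` for which the
largest element of `L △ R` lies in `R`. -/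
theorem sum_prod_lex_lt_le_prod_sub_one {α : Type*} [DecidableEq α] {A : Set α} {r : α → α → Prop}
    (hr : IsLinearOrderOn A r) (m : α → ℝ) (hm : ∀ a ∈ A, 0 ≤ m a) (U : Finset α) :
    ↑U ⊆ A → (∀ a ∈ U, ∏ x ∈ U.filter (fun x => r x a ∧ x ≠ a), (1 + m x) < m a) →
    ∀ R ⊆ U, ∑ L ∈ U.powerset with ¬ L ⊆ R ∧
        ∃ a ∈ R, a ∉ L ∧ ∀ b ∈ symmDiff L R, r b a, ∏ x ∈ L, m x ≤ ∏ x ∈ R, m x - 1 := by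
  induction U using Finset.strongInduction with
  | H U ih =>
  intro hUA hheavy R hRU
  rcases U.eq_empty_or_nonempty with rfl | hne
  · obtain rfl : R = ∅ := Finset.subset_empty.1 hRU
    simp
  obtain ⟨a, haU, hmax⟩ := exists_greatest_of_isLinearOrderOn hr U hUA hne
  obtain ⟨U', haU', rfl⟩ : ∃ U', a ∉ U' ∧ insert a U' = U :=
    ⟨U.erase a, by simp, Finset.insert_erase haU⟩
  have hU'A : ↑U' ⊆ A := fun x hx => hUA (by simp_all)
  have hnn : ∀ L ⊆ U', 0 ≤ ∏ x ∈ L, m x := fun L hL =>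
    Finset.prod_nonneg fun x hx => hm x (hU'A (hL hx))
  have hfil : (insert a U').filter (fun x => r x a ∧ x ≠ a) = U' := by
    ext x
    simp only [Finset.mem_filter, Finset.mem_insert]
    constructor
    · tauto
    · exact fun hx => ⟨.inr hx, hmax x (by simp [hx]), fun h => haU' (h ▸ hx)⟩
  have hma := hheavy a haU
  rw [hfil, Finset.prod_one_add] at hma
  have hheavy' : ∀ b ∈ U', ∏ x ∈ U'.filter (fun x => r x b ∧ x ≠ b), (1 + m x) < m b := by
    intro b hb
    refine lt_of_le_of_lt ?_ (hheavy b (by simp [hb]))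
    refine Finset.prod_le_prod_of_subset_of_one_le ?_ ?_ ?_
    · exact Finset.filter_subset_filter _ (Finset.subset_insert _ _)
    · intro x hx
      have := hm x (hU'A (Finset.mem_filter.1 hx).1)
      linarith
    · intro x hx _
      have := hm x (hUA (Finset.mem_filter.1 hx).1)
      linarith
  have ih' := ih U' (Finset.ssubset_insert haU') hU'A hheavy'
  rw [Finset.sum_filter, Finset.sum_powerset_insert haU', ← Finset.sum_filter, ← Finset.sum_filter]
  by_cases haR : a ∈ R
  · obtain ⟨R', haR', rfl⟩ : ∃ R', a ∉ R' ∧ insert a R' = R :=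
      ⟨R.erase a, by simp, Finset.insert_erase haR⟩
    have hR'U : R' ⊆ U' := fun x hx => by
      have := hRU (Finset.mem_insert_of_mem hx)
      rcases Finset.mem_insert.1 this with rfl | h
      exacts [absurd hx haR', h]
    have h1 : ∑ L ∈ U'.powerset with ¬ L ⊆ insert a R' ∧
        ∃ c ∈ insert a R', c ∉ L ∧ ∀ b ∈ symmDiff L (insert a R'), r b c, ∏ x ∈ L, m x
        ≤ ∑ L ∈ U'.powerset, ∏ x ∈ L, m x - 1 := by
      have : ∑ L ∈ U'.powerset, ∏ x ∈ L, m x - 1 = ∑ L ∈ U'.powerset.erase ∅, ∏ x ∈ L, m x := by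
        rw [← Finset.add_sum_erase U'.powerset _ (Finset.empty_mem_powerset U')]
        simp
      rw [this]
      refine Finset.sum_le_sum_of_subset_of_nonneg ?_ ?_
      · intro L hL
        simp only [Finset.mem_filter, Finset.mem_erase] at hL ⊢
        exact ⟨fun h => hL.2.1 (by simp [h]), hL.1⟩
      · exact fun L hL _ => hnn L (Finset.mem_powerset.1 (Finset.mem_of_mem_erase hL))
    have h2 : ∑ L ∈ U'.powerset with ¬ insert a L ⊆ insert a R' ∧
        ∃ c ∈ insert a R', c ∉ insert a L ∧
          ∀ b ∈ symmDiff (insert a L) (insert a R'), r b c, ∏ x ∈ insert a L, m x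
        ≤ m a * (∏ x ∈ R', m x - 1) := by
      refine le_trans ?_ (mul_le_mul_of_nonneg_left (ih' R' hR'U) (hm a (hUA haU)))
      rw [Finset.mul_sum]
      refine le_trans (Finset.sum_le_sum_of_subset_of_nonneg ?_ ?_)
        (Finset.sum_congr rfl fun L hL => ?_).le
      · intro L hL
        simp only [Finset.mem_filter, Finset.mem_powerset] at hL ⊢
        obtain ⟨hLU, hn, c, hc, hcL, hb⟩ := hL
        have haL : a ∉ L := fun h => haU' (hLU h)
        refine ⟨hLU, fun h => hn (Finset.insert_subset_insert a h), c, ?_, ?_, fun b hbs => hb b ?_⟩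
        · simp_all only [Finset.mem_insert, not_or]; tauto
        · simp_all
        · have hba : b ≠ a := by
            rintro rfl
            simp only [Finset.mem_symmDiff] at hbs; tauto
          simp only [Finset.mem_symmDiff, Finset.mem_insert] at hbs ⊢; tauto
      · intro L hL _
        have hLU := Finset.mem_powerset.1 (Finset.mem_filter.1 hL).1
        exact Finset.prod_nonneg fun x hx =>
          hm x (hUA (Finset.insert_subset_insert a hLU hx))
      · have hLU := Finset.mem_powerset.1 (Finset.mem_filter.1 hL).1
        rw [Finset.prod_insert fun h => haU' (hLU h)]
    rw [Finset.prod_insert haR']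
    linarith
  · have hRU' : R ⊆ U' := fun x hx => by
      rcases Finset.mem_insert.1 (hRU hx) with rfl | h
      exacts [absurd hx haR, h]
    have h2 : ∑ L ∈ U'.powerset with ¬ insert a L ⊆ R ∧
        ∃ c ∈ R, c ∉ insert a L ∧
          ∀ b ∈ symmDiff (insert a L) R, r b c, ∏ x ∈ insert a L, m x = 0 := by
      rw [Finset.filter_eq_empty_iff.2, Finset.sum_empty]
      rintro L - ⟨-, c, hc, -, hb⟩
      have h1 := hb a (by simp [Finset.mem_symmDiff, haR])
      have h2 := hmax c (hRU hc)
      exact haR (hr.2.1 a (hUA haU) c (hUA (hRU hc)) h1 h2 ▸ hc)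
    rw [h2, add_zero]
    exact ih' R hRU'

/-- The bound of `sum_prod_lex_lt_le_prod_sub_one` for an arbitrary family of such sets `L`. -/
theorem sum_prod_le_prod_sub_one {α : Type*} [DecidableEq α] {A : Set α} {r : α → α → Prop}
    (hr : IsLinearOrderOn A r) (m : α → ℝ) (hm : ∀ a ∈ A, 0 ≤ m a) (U : Finset α) (hUA : ↑U ⊆ A)
    [∀ a, DecidablePred fun x => r x a ∧ x ≠ a]
    (hheavy : ∀ a ∈ U, ∏ x ∈ U.filter (fun x => r x a ∧ x ≠ a), (1 + m x) < m a)
    (R : Finset α) (hRU : R ⊆ U) (F : Finset (Finset α))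
    (hF : ∀ L ∈ F, L ⊆ U ∧ ¬ L ⊆ R ∧ ∃ a ∈ R, a ∉ L ∧ ∀ b, (b ∈ L ↔ b ∉ R) → r b a) :
    ∑ L ∈ F, ∏ x ∈ L, m x ≤ ∏ x ∈ R, m x - 1 := by
  classical
  refine le_trans ?_ (sum_prod_lex_lt_le_prod_sub_one hr m hm U hUA
    (fun a ha => by convert hheavy a ha) R hRU)
  refine Finset.sum_le_sum_of_subset_of_nonneg (fun L hL => ?_) fun L hL _ => ?_
  · obtain ⟨hLU, hLR, a, ha, haL, hb⟩ := hF L hL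
    refine Finset.mem_filter.2 ⟨Finset.mem_powerset.2 hLU, hLR, a, ha, haL, fun b hbs => hb b ?_⟩
    rw [Finset.mem_symmDiff] at hbs
    tauto
  · have hLU := Finset.mem_powerset.1 (Finset.mem_filter.1 hL).1
    exact Finset.prod_nonneg fun x hx => hm x (hUA (hLU hx))

/-! ### The determinant of a path matrix as a signed sum over disjoint path families -/

open Classical in
/-- The sum of the weights of all pairwise disjoint families `p` with `p i ∈ P i`. -/
noncomputable def disjointFamilySum {V ι K : Type*} [Fintype ι] [DecidableEq ι] [CommRing K]
    (wt : List V → K) (P : ι → Finset (List V)) : K :=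
  ∑ p ∈ Fintype.piFinset P with ∀ i j, i ≠ j → (p i).Disjoint (p j), ∏ i, wt (p i)

open Classical in
/-- Splitting off the first vertex `v` of the `k`-th member of a family of disjoint lists. -/
theorem disjointFamilySum_eq_sum_update {V ι γ K : Type*} [Fintype ι] [DecidableEq ι] [CommRing K]
    (wt : List V → K) (P : ι → Finset (List V)) (k : ι) (v : V) (N : Finset γ) (ω : γ → K)
    (Q : γ → Finset (List V))
    (hP : ∀ p, p ∈ P k ↔ ∃ y ∈ N, ∃ q ∈ Q y, p = v :: q)
    (hQ : ∀ y ∈ N, ∀ z ∈ N, ∀ q, q ∈ Q y → q ∈ Q z → y = z)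
    (hwt : ∀ y ∈ N, ∀ q ∈ Q y, wt (v :: q) = ω y * wt q)
    (hv : ∀ i, i ≠ k → ∀ p ∈ P i, v ∉ p) :
    disjointFamilySum wt P =
      ∑ y ∈ N, ω y * disjointFamilySum wt (Function.update P k (Q y)) := by
  simp only [disjointFamilySum, Finset.mul_sum]
  rw [Finset.sum_sigma']
  symm
  refine Finset.sum_bij (fun x _ => Function.update x.2 k (v :: x.2 k)) ?_ ?_ ?_ ?_
  · rintro ⟨y, p⟩ hp
    simp only [Finset.mem_sigma, Finset.mem_filter, Fintype.mem_piFinset] at hp ⊢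
    obtain ⟨hy, hp, hd⟩ := hp
    have hk : p k ∈ Q y := by simpa using hp k
    have hi : ∀ i, i ≠ k → p i ∈ P i := fun i hi => by simpa [hi] using hp i
    refine ⟨fun i => ?_, fun i j hij => ?_⟩
    · by_cases h : i = k
      · subst h
        simpa using (hP _).2 ⟨y, hy, _, hk, rfl⟩
      · simpa [h] using hi i h
    · by_cases h : i = k
      · subst h
        have hj : j ≠ i := hij.symm
        simp only [Function.update_self, Function.update_of_ne hj, List.disjoint_cons_left]
        exact ⟨hv j hj _ (hi j hj), hd i j hij⟩
      · by_cases h' : j = k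
        · subst h'
          simp only [Function.update_self, Function.update_of_ne hij, List.disjoint_cons_right]
          exact ⟨hv i hij _ (hi i hij), hd i j hij⟩
        · simpa [h, h'] using hd i j hij
  · rintro ⟨y, p⟩ hp ⟨z, q⟩ hq h
    simp only [Finset.mem_sigma, Finset.mem_filter, Fintype.mem_piFinset] at hp hq
    have hpq : p = q := by
      funext i
      have := congrFun h i
      by_cases hi : i = k
      · subst hi; simpa using this
      · simpa [hi] using this
    subst hpq
    obtain rfl : y = z := hQ y hp.1 z hq.1 (p k) (by simpa using hp.2.1 k) (by simpa using hq.2.1 k)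
    rfl
  · intro p hp
    simp only [Finset.mem_filter, Fintype.mem_piFinset] at hp
    obtain ⟨hp, hd⟩ := hp
    obtain ⟨y, hy, q, hq, hpk⟩ := (hP _).1 (hp k)
    refine ⟨⟨y, Function.update p k q⟩, ?_, ?_⟩
    · simp only [Finset.mem_sigma, Finset.mem_filter, Fintype.mem_piFinset]
      have hsub : ∀ i, Function.update p k q i ⊆ p i := by
        intro i
        by_cases h : i = k
        · subst h; simp [hpk]
        · simp [h]
      refine ⟨hy, fun i => ?_, fun i j hij x hx hx' => hd i j hij (hsub i hx) (hsub j hx')⟩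
      by_cases h : i = k
      · subst h; simpa using hq
      · simpa [h] using hp i
    · simp [← hpk]
  · rintro ⟨y, p⟩ hp
    simp only [Finset.mem_sigma, Finset.mem_filter, Fintype.mem_piFinset] at hp
    have hk : p k ∈ Q y := by simpa using hp.2.1 k
    have : (fun i => wt (Function.update p k (v :: p k) i)) =
        Function.update (fun i => wt (p i)) k (ω y * wt (p k)) := by
      funext i
      by_cases h : i = k
      · subst h; simp [hwt y hp.1 _ hk]
      · simp [h]
    simp only [this]
    rw [Finset.prod_update_of_mem (Finset.mem_univ k), mul_assoc,
      Finset.sdiff_singleton_eq_erase,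
      Finset.mul_prod_erase Finset.univ (fun i => wt (p i)) (Finset.mem_univ k)]

open Classical in
/-- **Lindström's lemma**, for path families given by a one-step recursion. A state is either a
vertex, from which a path still has to be continued to a target, or the index of the target
that has been reached; `P x j` is the set of possible continuations from the state `x` that end in
the target `j`. -/
theorem det_eq_sum_disjointFamilySum {V ι K : Type*} [Fintype ι] [DecidableEq ι] [CommRing K]
    (wt : List V → K) (P : V ⊕ ι → ι → Finset (List V)) (N : V → Finset (V ⊕ ι))
    (ω : V → V ⊕ ι → K) (h : V → ℕ)
    (hinr : ∀ i j, P (.inr i) j = if i = j then {[]} else ∅)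
    (hinl : ∀ v j p, p ∈ P (.inl v) j ↔ ∃ y ∈ N v, ∃ q ∈ P y j, p = v :: q)
    (huniq : ∀ v j, ∀ y ∈ N v, ∀ z ∈ N v, ∀ q, q ∈ P y j → q ∈ P z j → y = z)
    (hwt : ∀ v j, ∀ y ∈ N v, ∀ q ∈ P y j, wt (v :: q) = ω v y * wt q)
    (hN : ∀ v u, .inl u ∈ N v → h u < h v)
    (hh : ∀ v j, ∀ p ∈ P (.inl v) j, ∀ x ∈ p, x = v ∨ h x < h v)
    (s : ι → V ⊕ ι) :
    (Matrix.of fun i j => ∑ p ∈ P (s i) j, wt p).det =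
      ∑ π : Equiv.Perm ι, ((Equiv.Perm.sign π : ℤ) : K) *
        disjointFamilySum wt fun i => P (s i) (π i) := by
  let ht : V ⊕ ι → ℕ := Sum.elim (fun v => h v + 1) fun _ => 0
  induction hn : ∑ i, ht (s i) using Nat.strong_induction_on generalizing s with
  | _ n ih =>
  by_cases hinj : Function.Injective s
  swap
  · obtain ⟨a, b, hab, hne⟩ : ∃ a b, s a = s b ∧ a ≠ b := by
      simpa [Function.Injective] using hinj
    rw [Matrix.det_zero_of_row_eq hne (by ext j; simp [hab])]
    symm
    refine Finset.sum_eq_zero fun π _ => ?_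
    rw [disjointFamilySum, Finset.filter_eq_empty_iff.2, Finset.sum_empty, mul_zero]
    intro p hp hd
    rw [Fintype.mem_piFinset] at hp
    have ha := hp a
    have hb := hp b
    rw [← hab] at hb
    cases hs : s a with
    | inl v =>
      rw [hs] at ha hb
      obtain ⟨y, -, q, -, hq⟩ := (hinl _ _ _).1 ha
      obtain ⟨y', -, q', -, hq'⟩ := (hinl _ _ _).1 hb
      exact hd a b hne (a := v) (by simp [hq]) (by simp [hq'])
    | inr j =>
      rw [hs, hinr] at ha hb
      have h1 : j = π a := by by_contra hc; simp [hc] at ha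
      have h2 : j = π b := by by_contra hc; simp [hc] at hb
      exact hne (π.injective (h1.symm.trans h2))
  by_cases hact : ∃ i v, s i = .inl v
  · obtain ⟨k, v, hk, hkmax⟩ : ∃ k v, s k = .inl v ∧ ∀ i u, s i = .inl u → h u ≤ h v := by
      obtain ⟨i₀, v₀, hi₀⟩ := hact
      obtain ⟨k, -, hk⟩ := Finset.exists_max_image Finset.univ (fun i => ht (s i)) ⟨i₀, by simp⟩
      cases hs : s k with
      | inl v =>
        refine ⟨k, v, hs, fun i u hu => ?_⟩
        have := hk i (by simp)
        simp only [hs, hu, ht, Sum.elim_inl] at this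
        omega
      | inr j =>
        have := hk i₀ (by simp)
        simp [hs, hi₀, ht] at this
    have hupd : ∀ y ∈ N v, ∑ i, ht (Function.update s k y i) < n := by
      intro y hy
      rw [← hn]
      refine Finset.sum_lt_sum (fun i _ => ?_) ⟨k, by simp, ?_⟩
      · by_cases hik : i = k
        · subst hik
          cases y with
          | inl u => have := hN v u hy; simp [ht, hk]; omega
          | inr j => simp [ht]
        · simp [hik]
      · cases y with
        | inl u => have := hN v u hy; simp [ht, hk]; omega
        | inr j => simp [ht, hk]
    have hrow : ∀ j, ∑ p ∈ P (.inl v) j, wt p = ∑ y ∈ N v, ω v y * ∑ p ∈ P y j, wt p := by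
      intro j
      simp only [Finset.mul_sum]
      rw [Finset.sum_sigma']
      symm
      refine Finset.sum_bij (fun x _ => v :: x.2) ?_ ?_ ?_ ?_
      · rintro ⟨y, q⟩ hq
        rw [Finset.mem_sigma] at hq
        exact (hinl _ _ _).2 ⟨y, hq.1, q, hq.2, rfl⟩
      · rintro ⟨y, q⟩ hq ⟨z, q'⟩ hq' heq
        rw [Finset.mem_sigma] at hq hq'
        obtain rfl : q = q' := by simpa using heq
        obtain rfl : y = z := huniq v j y hq.1 z hq'.1 q hq.2 hq'.2
        rfl
      · intro p hp
        obtain ⟨y, hy, q, hq, rfl⟩ := (hinl _ _ _).1 hp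
        exact ⟨⟨y, q⟩, Finset.mem_sigma.2 ⟨hy, hq⟩, rfl⟩
      · rintro ⟨y, q⟩ hq
        rw [Finset.mem_sigma] at hq
        exact (hwt v j y hq.1 q hq.2).symm
    have hdet : (Matrix.of fun i j => ∑ p ∈ P (s i) j, wt p).det =
        ∑ y ∈ N v, ω v y *
          (Matrix.of fun i j => ∑ p ∈ P (Function.update s k y i) j, wt p).det := by
      let M : ι → ι → K := fun i j => ∑ p ∈ P (s i) j, wt p
      have hM : M = Function.update M k (∑ y ∈ N v, ω v y • fun j => ∑ p ∈ P y j, wt p) := by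
        refine (Function.update_eq_self_iff.2 ?_).symm
        funext j
        simp [M, hk, hrow]
      change Matrix.detRowAlternating M = _
      rw [hM, AlternatingMap.map_update_sum]
      refine Finset.sum_congr rfl fun y _ => ?_
      rw [AlternatingMap.map_update_smul, smul_eq_mul]
      change _ = _ * Matrix.detRowAlternating fun i j => ∑ p ∈ P (Function.update s k y i) j, wt p
      congr 2
      funext i
      by_cases hik : i = k
      · subst hik; simp
      · simp [hik, M]
    rw [hdet, Finset.sum_congr rfl fun y hy => by rw [ih _ (hupd y hy) _ rfl]]
    simp only [Finset.mul_sum]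
    rw [Finset.sum_comm]
    refine Finset.sum_congr rfl fun π _ => ?_
    rw [disjointFamilySum_eq_sum_update wt (fun i => P (s i) (π i)) k v (N v) (ω v)
      (fun y => P y (π k)) (by simpa [hk] using hinl v (π k)) (huniq v (π k)) (hwt v (π k)) ?_,
      Finset.mul_sum]
    · refine Finset.sum_congr rfl fun y _ => ?_
      rw [mul_left_comm]
      congr 3
      funext i
      by_cases hik : i = k
      · subst hik; simp
      · simp [hik]
    · intro i hik p hp hvp
      cases hs : s i with
      | inl u =>
        rw [hs] at hp
        rcases hh u _ p hp v hvp with rfl | hlt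
        · exact hik (hinj (hs.trans hk.symm))
        · exact absurd (hkmax i u hs) (by omega)
      | inr j =>
        rw [hs, hinr] at hp
        split_ifs at hp
        · rw [Finset.mem_singleton.1 hp] at hvp
          exact List.not_mem_nil hvp
        · exact Finset.notMem_empty _ hp
  · have hs : ∀ i, ∃ j, s i = .inr j := by
      intro i
      cases hsi : s i with
      | inl v => exact absurd ⟨i, v, hsi⟩ hact
      | inr j => exact ⟨j, rfl⟩
    rw [← Matrix.det_transpose, Matrix.det_apply']
    refine Finset.sum_congr rfl fun π _ => ?_
    simp only [Matrix.transpose_apply, Matrix.of_apply]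
    rw [Finset.prod_univ_sum, disjointFamilySum, Finset.filter_true_of_mem]
    intro p hp i j _
    obtain ⟨l, hl⟩ := hs i
    have := Fintype.mem_piFinset.1 hp i
    rw [hl, hinr] at this
    split_ifs at this
    · rw [Finset.mem_singleton.1 this]
      exact List.disjoint_nil_left _
    · exact absurd this (Finset.notMem_empty _)

/-! ### Paths in finite acyclic digraphs -/

section Paths

variable {V : Type*} {A : Set (V × V)}

/-- Every walk in an acyclic digraph is a path. -/
theorem nodup_of_isChain_of_acyclic (hacyclic : ∀ p : List V, ¬ IsCycle A p) :
    ∀ p : List V, p.IsChain (fun u v => (u, v) ∈ A) → p.Nodup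
  | [], _ => List.nodup_nil
  | a :: l, hp => by
    have hl := nodup_of_isChain_of_acyclic hacyclic l hp.tail
    refine List.nodup_cons.2 ⟨fun ha => ?_, hl⟩
    obtain ⟨s, t, rfl⟩ := List.append_of_mem ha
    have hs : (a :: s).Nodup := by
      rw [List.nodup_cons]
      exact ⟨fun h => (List.nodup_append.1 hl).2.2 a h a (by simp) rfl, (List.nodup_append.1 hl).1⟩
    have hpre : (a :: s ++ [a]) <+: a :: (s ++ a :: t) := ⟨t, by simp⟩
    have hc := hp.prefix hpre
    refine hacyclic (a :: s ++ [a]) ⟨⟨by simp, hc⟩, by simp, ?_, ?_⟩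
    · rw [List.getLast?_concat]; rfl
    rw [List.dropLast_concat]
    exact ⟨⟨by simp, hc.prefix (List.prefix_append _ _)⟩, hs⟩

/-- The vertices of a walk other than its first vertex have smaller height. -/
theorem eq_or_height_lt_of_mem {h : V → ℕ} (hh : ∀ u v, (u, v) ∈ A → h v < h u) :
    ∀ (p : List V) (v : V), (v :: p).IsChain (fun u v => (u, v) ∈ A) →
      ∀ x ∈ v :: p, x = v ∨ h x < h v
  | [], v, _, x, hx => .inl (by simpa using hx)
  | u :: p, v, hc, x, hx => by
    rw [List.isChain_cons_cons] at hc
    rcases List.mem_cons.1 hx with rfl | hx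
    · exact .inl rfl
    · rcases eq_or_height_lt_of_mem hh p u hc.2 x hx with rfl | hlt
      · exact .inr (hh _ _ hc.1)
      · exact .inr (hlt.trans (hh _ _ hc.1))

variable [Finite V]

theorem finite_setOf_isPath (A : Set (V × V)) : {p : List V | IsPath A p}.Finite := by
  cases nonempty_fintype V
  exact (Set.finite_coe_iff.1 (Finite.of_fintype {l : List V // l.Nodup})).subset fun p hp => hp.2

/-- A finite acyclic digraph has a height function that strictly decreases along arcs. -/
theorem exists_height_of_acyclic (hacyclic : ∀ p : List V, ¬ IsCycle A p) :
    ∃ h : V → ℕ, ∀ u v, (u, v) ∈ A → h v < h u := by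
  refine ⟨fun v => {p | IsPath A p ∧ p.head? = some v}.ncard, fun u v huv => ?_⟩
  have hinj : Function.Injective (List.cons u) := List.cons_injective
  change Set.ncard _ < Set.ncard _
  rw [← Set.ncard_image_of_injective _ hinj]
  refine Set.ncard_lt_ncard ⟨?_, fun hsub => ?_⟩
    ((finite_setOf_isPath A).subset fun p hp => hp.1)
  · rintro _ ⟨p, ⟨hp, hpv⟩, rfl⟩
    have hc : (u :: p).IsChain fun u v => (u, v) ∈ A :=
      List.isChain_cons.2 ⟨fun y hy => by simp_all, hp.1.2⟩
    exact ⟨⟨⟨by simp, hc⟩, nodup_of_isChain_of_acyclic hacyclic _ hc⟩, rfl⟩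
  · obtain ⟨p, ⟨hp, -⟩, hpu⟩ := hsub (show [u] ∈ {p | IsPath A p ∧ p.head? = some u} from
      ⟨⟨⟨by simp, List.isChain_singleton u⟩, List.nodup_singleton u⟩, rfl⟩)
    exact hp.1.1 (by simpa using hpu)

/-- The finite set of paths from `u` to `v`. -/
noncomputable def pathFinset (A : Set (V × V)) (u v : V) : Finset (List V) :=
  Set.Finite.toFinset (s := {p | IsPath A p ∧ p.head? = some u ∧ p.getLast? = some v})
    ((finite_setOf_isPath A).subset fun _ hp => hp.1)

theorem mem_pathFinset {u v : V} {p : List V} :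
    p ∈ pathFinset A u v ↔ IsPath A p ∧ p.head? = some u ∧ p.getLast? = some v := by
  simp [pathFinset]

theorem pathMatrix_eq_sum (A : Set (V × V)) (w : V × V → ℝ) (u v : V) :
    pathMatrix A w u v = ∑ p ∈ pathFinset A u v, pathProd w p := by
  rw [pathMatrix, ← finsum_mem_coe_finset]
  simp [pathFinset]

theorem cons_mem_pathFinset (hacyclic : ∀ p : List V, ¬ IsCycle A p) {u v t : V} {p : List V}
    (huv : (u, v) ∈ A) (hp : p ∈ pathFinset A v t) : u :: p ∈ pathFinset A u t := by
  rw [mem_pathFinset] at hp ⊢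
  obtain ⟨hp, hpv, hpt⟩ := hp
  have hc : (u :: p).IsChain fun u v => (u, v) ∈ A :=
    List.isChain_cons.2 ⟨fun y hy => by simp_all, hp.1.2⟩
  refine ⟨⟨⟨by simp, hc⟩, nodup_of_isChain_of_acyclic hacyclic _ hc⟩, rfl, ?_⟩
  rw [List.getLast?_cons, hpt, Option.getD_some]

open Classical in
/-- **Lindström's lemma** for the path matrix of a finite acyclic digraph. -/
theorem det_pathMatrix_eq_sum {ι : Type*} [Fintype ι] [DecidableEq ι]
    (hacyclic : ∀ p : List V, ¬ IsCycle A p) (w : V × V → ℝ) (s t : ι → V) :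
    (Matrix.of fun i j => pathMatrix A w (s i) (t j)).det =
      ∑ π : Equiv.Perm ι, ((Equiv.Perm.sign π : ℤ) : ℝ) *
        disjointFamilySum (pathProd w) fun i => pathFinset A (s i) (t (π i)) := by
  cases nonempty_fintype V
  obtain ⟨h, hh⟩ := exists_height_of_acyclic hacyclic
  simp only [pathMatrix_eq_sum]
  refine det_eq_sum_disjointFamilySum (pathProd w)
    (fun x j => Sum.elim (fun v => pathFinset A v (t j)) (fun i => if i = j then {[]} else ∅) x)
    (fun v => Finset.univ.filter fun y => Sum.elim (fun u => (v, u) ∈ A) (fun j => t j = v) y)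
    (fun v y => Sum.elim (fun u => w (v, u)) (fun _ => 1) y) h
    (fun i j => rfl) ?_ ?_ ?_ ?_ ?_ (fun i => .inl (s i))
  · intro v j p
    simp only [Sum.elim_inl, Finset.mem_filter, Finset.mem_univ, true_and, Sum.exists, Sum.elim_inr]
    constructor
    · intro hp
      have hp' := hp
      rw [mem_pathFinset] at hp
      obtain ⟨⟨⟨hne, hc⟩, hnd⟩, hhead, hlast⟩ := hp
      match p, hhead with
      | [_], rfl => exact .inr ⟨j, by simpa using hlast.symm, [], by simp, rfl⟩
      | _ :: u :: q, rfl =>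
        have hc' := List.isChain_cons_cons.1 hc
        refine .inl ⟨u, hc'.1, u :: q, mem_pathFinset.2 ⟨⟨⟨by simp, hc'.2⟩, hnd.tail⟩, rfl, ?_⟩, rfl⟩
        simpa using hlast
    · rintro (⟨u, hu, q, hq, rfl⟩ | ⟨i, rfl, q, hq, rfl⟩)
      · exact cons_mem_pathFinset hacyclic hu hq
      · split_ifs at hq with hij
        · rw [Finset.mem_singleton.1 hq, hij, mem_pathFinset]
          exact ⟨⟨⟨by simp, List.isChain_singleton _⟩, List.nodup_singleton _⟩, rfl, rfl⟩
        · exact absurd hq (Finset.notMem_empty _)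
  · have hnil : ∀ (u : V) (j : ι), [] ∉ pathFinset A u (t j) := by simp [mem_pathFinset]
    rintro v j (y | y) - (z | z) - q hq hq'
    · simp only [Sum.elim_inl, mem_pathFinset] at hq hq'
      rw [hq.2.1] at hq'
      simpa using hq'.2.1
    · simp only [Sum.elim_inl, Sum.elim_inr] at hq hq'
      split_ifs at hq' <;> simp_all
    · simp only [Sum.elim_inl, Sum.elim_inr] at hq hq'
      split_ifs at hq <;> simp_all
    · simp only [Sum.elim_inr] at hq hq'
      split_ifs at hq hq' <;> simp_all
  · rintro v j (u | i) - q hq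
    · simp only [Sum.elim_inl, mem_pathFinset] at hq
      match q, hq.2.1 with
      | _ :: q, rfl => simp [pathProd]
    · simp only [Sum.elim_inr] at hq
      split_ifs at hq
      · rw [Finset.mem_singleton.1 hq]; simp [pathProd]
      · exact absurd hq (Finset.notMem_empty _)
  · intro v u hu
    exact hh v u (by simpa using hu)
  · intro v j p hp x hx
    simp only [Sum.elim_inl, mem_pathFinset] at hp
    match p, hp.2.1 with
    | _ :: q, rfl => exact eq_or_height_lt_of_mem hh q _ hp.1.1.2 x hx

end Paths

/-! ### Arc sets of disjoint path families -/

section Families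

variable {V ι : Type*}

theorem nodup_zip_tail {p : List V} (hp : p.Nodup) : (p.zip p.tail).Nodup := by
  refine List.Nodup.of_map Prod.snd ?_
  rw [List.map_snd_zip (by simp)]
  exact hp.tail

theorem mem_zip_tail_iff {p : List V} {a b : V} :
    (a, b) ∈ p.zip p.tail ↔ ∃ l l', p = l ++ a :: b :: l' := by
  induction p with
  | nil => simp
  | cons x p ih =>
    cases p with
    | nil =>
      simp only [List.tail_cons, List.zip_nil_right, List.not_mem_nil, false_iff, not_exists]
      intro l l' h
      have := congrArg List.length h
      simp at this
      omega
    | cons y p =>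
      simp only [List.tail_cons, List.zip_cons_cons, List.mem_cons, Prod.mk.injEq] at ih ⊢
      rw [ih]
      constructor
      · rintro (⟨rfl, rfl⟩ | ⟨l, l', h⟩)
        · exact ⟨[], p, rfl⟩
        · exact ⟨x :: l, l', by simp [h]⟩
      · rintro ⟨l, l', h⟩
        cases l with
        | nil => simp_all
        | cons z l => exact .inr ⟨l, l', by simp_all⟩

/-- A walk that starts on a suffix of the path `pre ++ q` and that uses only arcs of `E` is a prefix
of that suffix, if all arcs of `E` leaving the path are arcs of the path. -/
theorem isPrefix_of_arcs_subset {E : Set (V × V)} :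
    ∀ (p pre q : List V), (pre ++ q).Nodup →
      (∀ x y, (x, y) ∈ E → x ∈ pre ++ q → (x, y) ∈ (pre ++ q).zip (pre ++ q).tail) →
      p.head? = q.head? → (∀ a ∈ p.zip p.tail, a ∈ E) → p <+: q
  | [], _, q, _, _, _, _ => List.nil_prefix
  | _ :: _, _, [], _, _, hh, _ => by simp at hh
  | [a], _, b :: q, _, _, hh, _ => by
    obtain rfl : a = b := by simpa using hh
    exact List.prefix_append [a] q
  | a :: b :: p, pre, c :: q, hnd, hE, hh, hp => by
    obtain rfl : a = c := by simpa using hh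
    obtain ⟨l, l', h⟩ := mem_zip_tail_iff.1 (hE a b (hp _ (by simp)) (by simp))
    have hnd' := hnd
    rw [h] at hnd'
    have ha : a ∉ l := fun hl => (List.nodup_append.1 hnd').2.2 a hl a (by simp) rfl
    have ha' : a ∉ b :: l' := (List.nodup_cons.1 (List.nodup_append.1 hnd').2.1).1
    obtain ⟨-, -, rfl⟩ := (List.append_cons_inj_of_notMem ha ha').1 h.symm
    have key : pre ++ a :: b :: l' = (pre ++ [a]) ++ b :: l' := by simp
    have ih := isPrefix_of_arcs_subset (b :: p) (pre ++ [a]) (b :: l') (key ▸ hnd) (key ▸ hE) rfl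
      fun x hx => hp x (by simp only [List.tail_cons, List.zip_cons_cons, List.mem_cons] at hx ⊢
                           exact .inr hx)
    exact (List.prefix_cons_inj a).2 ih

/-- A family of pairwise disjoint paths, the `i`-th one leading from `s i` to `t (π i)`. -/
structure IsPathFamily (A : Set (V × V)) (s t : ι → V) (π : Equiv.Perm ι) (p : ι → List V) :
    Prop where
  isPath : ∀ i, IsPath A (p i)
  head : ∀ i, (p i).head? = some (s i)
  last : ∀ i, (p i).getLast? = some (t (π i))
  disjoint : ∀ i j, i ≠ j → (p i).Disjoint (p j)

namespace IsPathFamily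

variable {A : Set (V × V)} {s t : ι → V} {π π' : Equiv.Perm ι} {p p' : ι → List V}

theorem eq_of_mem (hp : IsPathFamily A s t π p) {i j : ι} {v : V} (hi : v ∈ p i) (hj : v ∈ p j) :
    i = j := by
  by_contra h
  exact hp.disjoint i j h hi hj

theorem injective (hp : IsPathFamily A s t π p) : Function.Injective p := fun i _ h =>
  hp.eq_of_mem (List.mem_of_mem_head? (hp.head i)) (h ▸ List.mem_of_mem_head? (hp.head i))

theorem perm_eq (hp : IsPathFamily A s t π p) (hp' : IsPathFamily A s t π' p)
    (ht : Function.Injective t) : π = π' := by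
  ext i
  have := hp.last i
  rw [hp'.last i] at this
  exact (ht (Option.some.inj this)).symm

theorem eq_of_range_eq (hp : IsPathFamily A s t π p) (hp' : IsPathFamily A s t π' p')
    (hs : Function.Injective s) (h : Set.range p = Set.range p') : p = p' := by
  funext i
  obtain ⟨j, hj⟩ : p i ∈ Set.range p' := h ▸ Set.mem_range_self i
  have := hp'.head j
  rw [hj, hp.head i] at this
  rw [← hj, hs (Option.some.inj this)]

theorem isRouting (hp : IsPathFamily A s t π p) {S T : Set V} (hS : Set.range s = S)
    (hT : Set.range t = T) : IsRouting A (Set.range p) S T := by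
  subst hS hT
  refine ⟨?_, ?_, ?_, ?_⟩
  · rintro _ ⟨i, rfl⟩
    exact hp.isPath i
  · rintro _ ⟨i, rfl⟩
    exact ⟨p i, ⟨i, rfl⟩, hp.head i⟩
  · rintro _ ⟨i, rfl⟩
    exact ⟨t (π i), ⟨_, rfl⟩, hp.last i⟩
  · rintro _ ⟨i, rfl⟩ _ ⟨j, rfl⟩
    by_cases h : i = j
    · exact .inl (h ▸ rfl)
    · exact .inr fun v hv hv' => hp.disjoint i j h hv hv'

end IsPathFamily

variable [Fintype ι]

open Classical in
/-- The arcs traversed by a family of paths. -/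
noncomputable def familyArcs (p : ι → List V) : Finset (V × V) :=
  Finset.univ.biUnion fun i => ((p i).zip (p i).tail).toFinset

theorem mem_familyArcs {p : ι → List V} {a : V × V} :
    a ∈ familyArcs p ↔ ∃ i, a ∈ (p i).zip (p i).tail := by
  simp [familyArcs]

theorem coe_familyArcs (p : ι → List V) :
    (familyArcs p : Set (V × V)) = routingArcs (Set.range p) := by
  ext a
  simp [mem_familyArcs, routingArcs, pathArcs]

namespace IsPathFamily

variable {A : Set (V × V)} {s t : ι → V} {π π' : Equiv.Perm ι} {p p' : ι → List V}

theorem familyArcs_subset (hp : IsPathFamily A s t π p) : ↑(familyArcs p) ⊆ A := by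
  rintro ⟨a, b⟩ hab
  obtain ⟨i, hi⟩ := mem_familyArcs.1 hab
  obtain ⟨l, l', h⟩ := mem_zip_tail_iff.1 hi
  have := (hp.isPath i).1.2
  rw [h] at this
  exact (List.isChain_cons_cons.1 (List.isChain_append.1 this).2.1).1

theorem prod_familyArcs (hp : IsPathFamily A s t π p) (f : V × V → ℝ) :
    ∏ a ∈ familyArcs p, f a = ∏ i, pathProd f (p i) := by
  classical
  rw [familyArcs, Finset.prod_biUnion]
  · exact Finset.prod_congr rfl fun i _ => List.prod_toFinset f (nodup_zip_tail (hp.isPath i).2)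
  · intro i _ j _ hij
    refine Finset.disjoint_left.2 ?_
    rintro ⟨a, b⟩ hi hj
    rw [List.mem_toFinset] at hi hj
    exact hp.disjoint i j hij (List.of_mem_zip hi).1 (List.of_mem_zip hj).1

/-- Distinct families of disjoint paths with the same starts and the same ends have incomparable
arc sets. -/
theorem eq_of_familyArcs_subset (hp : IsPathFamily A s t π p) (hp' : IsPathFamily A s t π' p')
    (h : familyArcs p ⊆ familyArcs p') : p = p' := by
  funext i
  have hpre : p i <+: p' i := by
    refine isPrefix_of_arcs_subset (E := familyArcs p') (p i) [] (p' i) (hp'.isPath i).2 ?_ ?_ ?_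
    · intro x y hxy hx
      obtain ⟨j, hj⟩ := mem_familyArcs.1 hxy
      obtain rfl := hp'.eq_of_mem hx (List.of_mem_zip hj).1
      exact hj
    · rw [hp.head, hp'.head]
    · exact fun a ha => h (mem_familyArcs.2 ⟨i, ha⟩)
  obtain ⟨l, hl⟩ := hpre
  have hlast := List.mem_of_mem_getLast? (hp.last i)
  obtain ⟨j, hj⟩ : ∃ j, π' j = π i := π'.surjective _
  have hj' := hp'.last j
  rw [hj] at hj'
  obtain rfl : i = j := hp'.eq_of_mem (hl ▸ List.mem_append_left l hlast)
    (List.mem_of_mem_getLast? hj')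
  rcases l.eq_nil_or_concat with rfl | ⟨l', b, rfl⟩
  · simpa using hl
  · have hb : b = t (π i) := by
      rw [← hl, List.concat_eq_append, ← List.append_assoc, List.getLast?_concat] at hj'
      exact Option.some.inj hj'
    have hnd := (hp'.isPath i).2
    rw [← hl, List.nodup_append] at hnd
    exact absurd rfl (hnd.2.2 _ hlast _ (by simp [hb]))

end IsPathFamily

end Families

/-! ### Signs -/

theorem neg_one_pow_card_inversions {n : ℕ} (π : Equiv.Perm (Fin n)) :
    (-1 : ℝ) ^ (Finset.univ.filter
      (fun ij : Fin n × Fin n => ij.1 < ij.2 ∧ π ij.2 < π ij.1)).card =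
      ((Equiv.Perm.sign π : ℤ) : ℝ) := by
  rw [Equiv.Perm.sign_eq_prod_prod_Iio, ← Finset.prod_const, Finset.prod_filter,
    Fintype.prod_prod_type_right]
  push_cast
  refine Finset.prod_congr rfl fun j _ => ?_
  have : Finset.Iio j = Finset.univ.filter (· < j) := by ext; simp
  rw [this, Finset.prod_filter]
  refine Finset.prod_congr rfl fun i _ => ?_
  by_cases hij : i < j
  · have : π i ≠ π j := fun h => hij.ne (π.injective h)
    rcases this.lt_or_gt with h | h
    · simp [hij, h, h.not_gt]
    · simp [hij, h, h.not_gt]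
  · simp [hij]

theorem real_sign_mul (x y : ℝ) : Real.sign (x * y) = Real.sign x * Real.sign y := by
  rcases lt_trichotomy x 0 with hx | rfl | hx <;> rcases lt_trichotomy y 0 with hy | rfl | hy
  · simp [Real.sign_of_neg hx, Real.sign_of_neg hy, Real.sign_of_pos (mul_pos_of_neg_of_neg hx hy)]
  · simp
  · simp [Real.sign_of_neg hx, Real.sign_of_pos hy, Real.sign_of_neg (mul_neg_of_neg_of_pos hx hy)]
  · simp
  · simp
  · simp
  · simp [Real.sign_of_pos hx, Real.sign_of_neg hy, Real.sign_of_neg (mul_neg_of_pos_of_neg hx hy)]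
  · simp
  · simp [Real.sign_of_pos hx, Real.sign_of_pos hy, Real.sign_of_pos (mul_pos hx hy)]

theorem real_sign_prod {ι : Type*} (s : Finset ι) (f : ι → ℝ) :
    Real.sign (∏ i ∈ s, f i) = ∏ i ∈ s, Real.sign (f i) := by
  classical
  induction s using Finset.induction_on with
  | empty => simp
  | insert a s ha ih =>
    rw [Finset.prod_insert ha, Finset.prod_insert ha, ← ih, real_sign_mul]

theorem real_sign_add_of_abs_lt {x e : ℝ} (h : |e| < |x|) : Real.sign (x + e) = Real.sign x := by
  rcases lt_trichotomy x 0 with hx | rfl | hx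
  · rw [abs_of_neg hx] at h
    rw [Real.sign_of_neg hx, Real.sign_of_neg (by linarith [le_abs_self e])]
  · simp only [abs_zero] at h
    exact absurd h (abs_nonneg e).not_gt
  · rw [abs_of_pos hx] at h
    rw [Real.sign_of_pos hx, Real.sign_of_pos (by linarith [neg_abs_le e])]

/-! ### The leading term of the determinant -/

open Classical in
/-- Heaviness in product form: the weight of `a` exceeds the product of `1 + |w x|` over `x ≪ a`. -/
theorem IsHeavyWeighting.prod_one_add_lt {V : Type*} [Finite V] {A : Set (V × V)}
    {σ : V × V → ℝ} {r : V × V → V × V → Prop} {w : V × V → ℝ} (hw : IsHeavyWeighting A σ r w)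
    (U : Finset (V × V)) (hU : ∀ x, x ∈ U ↔ x ∈ A) (a : V × V) (ha : a ∈ A) :
    ∏ x ∈ U.filter (fun x => r x a ∧ x ≠ a), (1 + |w x|) < |w a| := by
  convert (hw.2 a ha).2.2
  have himage : {L : Set (V × V) | L ⊆ {x ∈ A | r x a ∧ x ≠ a}} =
      (fun F : Finset (V × V) => (F : Set (V × V))) ''
        ((U.filter (fun x => r x a ∧ x ≠ a)).powerset : Set (Finset (V × V))) := by
    ext L
    constructor
    · intro hL
      refine ⟨(Set.toFinite L).toFinset, ?_, by simp⟩
      rw [Finset.mem_coe, Finset.mem_powerset]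
      intro x hx
      have := hL ((Set.toFinite L).mem_toFinset.1 hx)
      exact Finset.mem_filter.2 ⟨(hU x).2 this.1, this.2⟩
    · rintro ⟨F, hF, rfl⟩ x hx
      have := Finset.mem_filter.1 (Finset.mem_powerset.1 (Finset.mem_coe.1 hF) hx)
      exact ⟨(hU x).1 this.1, this.2⟩
  rw [Finset.prod_one_add, himage, finsum_mem_image Finset.coe_injective.injOn,
    finsum_mem_coe_finset]
  exact Finset.sum_congr rfl fun F _ => (finprod_mem_coe_finset _ F).symm

open Classical in
/-- The term of the greatest family of disjoint paths determines the sign of the determinant. -/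
theorem sign_det_pathMatrix_of_greatest {V ι : Type*} [Finite V] [Fintype ι] [DecidableEq ι]
    {A : Set (V × V)} (hacyclic : ∀ p : List V, ¬ IsCycle A p)
    {σ : V × V → ℝ} {r : V × V → V × V → Prop} (hr : IsLinearOrderOn A r)
    {w : V × V → ℝ} (hw : IsHeavyWeighting A σ r w) {s t : ι → V} (ht : Function.Injective t)
    {π : Equiv.Perm ι} {p : ι → List V} (hp : IsPathFamily A s t π p)
    (hmax : ∀ π' p', IsPathFamily A s t π' p' → p' ≠ p →
      RoutingLT r (Set.range p') (Set.range p)) :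
    Real.sign (Matrix.of fun i j => pathMatrix A w (s i) (t j)).det =
      ((Equiv.Perm.sign π : ℤ) : ℝ) * ∏ i, pathProd σ (p i) := by
  cases nonempty_fintype V
  set F : Finset (Σ _ : Equiv.Perm ι, ι → List V) := Finset.univ.sigma fun π =>
    (Fintype.piFinset fun i => pathFinset A (s i) (t (π i))).filter
      fun p => ∀ i j, i ≠ j → (p i).Disjoint (p j) with hF
  have hmem : ∀ x, x ∈ F ↔ IsPathFamily A s t x.1 x.2 := by
    rintro ⟨π', p'⟩
    simp only [hF, Finset.mem_sigma, Finset.mem_univ, true_and, Finset.mem_filter,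
      Fintype.mem_piFinset, mem_pathFinset]
    exact ⟨fun h => ⟨fun i => (h.1 i).1, fun i => (h.1 i).2.1, fun i => (h.1 i).2.2, h.2⟩,
      fun h => ⟨fun i => ⟨h.isPath i, h.head i, h.last i⟩, h.disjoint⟩⟩
  have hdet : (Matrix.of fun i j => pathMatrix A w (s i) (t j)).det =
      ∑ x ∈ F, ((Equiv.Perm.sign x.1 : ℤ) : ℝ) * ∏ a ∈ familyArcs x.2, w a := by
    rw [det_pathMatrix_eq_sum hacyclic]
    simp only [disjointFamilySum, Finset.mul_sum]
    rw [Finset.sum_sigma']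
    refine Finset.sum_congr rfl fun x hx => ?_
    rw [((hmem x).1 hx).prod_familyArcs]
  have hunits : ∀ π : Equiv.Perm ι, |((Equiv.Perm.sign π : ℤ) : ℝ)| = 1 := by
    intro π
    rcases Int.units_eq_one_or (Equiv.Perm.sign π) with h | h <;> simp [h]
  have hpF : (⟨π, p⟩ : Σ _ : Equiv.Perm ι, ι → List V) ∈ F := (hmem _).2 hp
  have hmain : |∑ x ∈ F.erase ⟨π, p⟩, ((Equiv.Perm.sign x.1 : ℤ) : ℝ) * ∏ a ∈ familyArcs x.2, w a|
      < |((Equiv.Perm.sign π : ℤ) : ℝ) * ∏ a ∈ familyArcs p, w a| := by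
    rw [abs_mul, hunits, one_mul, Finset.abs_prod]
    let U : Finset (V × V) := Finset.univ.filter (· ∈ A)
    have hU : ∀ x, x ∈ U ↔ x ∈ A := by simp [U]
    have hUA : ↑U ⊆ A := fun x hx => (hU x).1 hx
    have hsub : ∀ {π' : Equiv.Perm ι} {p' : ι → List V}, IsPathFamily A s t π' p' →
        familyArcs p' ⊆ U := fun h x hx => (hU x).2 (h.familyArcs_subset hx)
    refine lt_of_le_of_lt ?_ (sub_one_lt _)
    refine (Finset.abs_sum_le_sum_abs _ _).trans ?_
    have hinj : Set.InjOn (fun x : Σ _ : Equiv.Perm ι, ι → List V => familyArcs x.2)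
        (F.erase ⟨π, p⟩) := by
      rintro ⟨π₁, p₁⟩ h₁ ⟨π₂, p₂⟩ h₂ h
      have h₁ := (hmem _).1 (Finset.mem_of_mem_erase h₁)
      have h₂ := (hmem _).1 (Finset.mem_of_mem_erase h₂)
      obtain rfl : p₁ = p₂ := h₁.eq_of_familyArcs_subset h₂ (subset_of_eq h)
      obtain rfl : π₁ = π₂ := h₁.perm_eq h₂ ht
      rfl
    simp only [abs_mul, hunits, one_mul, Finset.abs_prod]
    rw [← Finset.sum_image (f := fun L => ∏ a ∈ L, |w a|) hinj]
    refine sum_prod_le_prod_sub_one hr (fun a => |w a|) (fun a _ => abs_nonneg _) U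
      hUA (fun a ha => hw.prod_one_add_lt U hU a (hUA ha)) (familyArcs p) (hsub hp) _ ?_
    intro L hL
    obtain ⟨⟨π', p'⟩, hx, rfl⟩ := Finset.mem_image.1 hL
    obtain ⟨hne, hx⟩ := Finset.mem_erase.1 hx
    have hp' : IsPathFamily A s t π' p' := (hmem _).1 hx
    have hpp : p' ≠ p := by
      rintro rfl
      exact hne (by rw [hp.perm_eq hp' ht])
    refine ⟨hsub hp',
      fun h => hpp (hp'.eq_of_familyArcs_subset hp h), ?_⟩
    obtain ⟨a, ha, had, hb⟩ := hmax π' p' hp' hpp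
    rw [← coe_familyArcs] at ha had
    rw [← coe_familyArcs, ← coe_familyArcs] at hb
    rw [← coe_familyArcs] at had
    refine ⟨a, ha, fun h => ?_, fun b hbs => hb b ?_⟩
    · exact had.elim (fun h' => h'.2 ha) fun h' => h'.2 h
    · simp only [Set.mem_symmDiff, Finset.mem_coe]
      tauto
  rw [hdet, ← Finset.add_sum_erase _ _ hpF, real_sign_add_of_abs_lt hmain, real_sign_mul,
    real_sign_prod, Real.sign_intCast, ← hp.prod_familyArcs]
  congr 1
  · rcases Int.units_eq_one_or (Equiv.Perm.sign π) with h | h <;> simp [h]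
  · exact Finset.prod_congr rfl fun a ha => (hw.2 a (hp.familyArcs_subset ha)).2.1

/-- For an acyclic digraph with a `(σ,≪)`-weighting, the sign of the determinant of the path
matrix on `S × T₀` equals the sign `sgn_σ(R)` of the `≪≪`-maximal routing `R` from `S` to
`T₀` (expressed via the map `φ` matching starts to ends of `R`). -/
theorem sign_det_eq_sign_max_routing {V : Type*} [Fintype V] [LinearOrder V]
    (A : Set (V × V)) (hacyclic : ∀ p : List V, ¬ IsCycle A p)
    (σ : V × V → ℝ) (hσ : ∀ a ∈ A, σ a = 1 ∨ σ a = -1)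
    (r : V × V → V × V → Prop) (hr : IsLinearOrderOn A r)
    (w : V × V → ℝ) (hw : IsHeavyWeighting A σ r w)
    (S T₀ : Finset V) (hcard : T₀.card = S.card)
    (hlink : ∃ L, IsLinking A L (↑S : Set V) (↑T₀ : Set V))
    (R : Set (List V)) (hR : IsMaxRouting r A R (↑S : Set V) (↑T₀ : Set V)) :
    ∀ φ : Fin S.card → Fin S.card,
      (∀ i, ∃ p ∈ R, p.head? = some ↑(S.orderIsoOfFin rfl i) ∧
          p.getLast? = some ↑(T₀.orderIsoOfFin hcard (φ i))) →
      Real.sign (Matrix.of fun i j =>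
          pathMatrix A w ↑(S.orderIsoOfFin rfl i) ↑(T₀.orderIsoOfFin hcard j)).det =
        (-1 : ℝ) ^ (Finset.univ.filter
            (fun ij : Fin S.card × Fin S.card => ij.1 < ij.2 ∧ φ ij.2 < φ ij.1)).card *
          ∏ᶠ p ∈ R, ((p.zip p.tail).map σ).prod := by

  intro φ hφ
  obtain ⟨⟨hRpath, hRstart, hRend, hRdisj⟩, hRmax⟩ := hR
  set s : Fin S.card → V := fun i => ↑(S.orderIsoOfFin rfl i) with hs_def
  set t : Fin S.card → V := fun j => ↑(T₀.orderIsoOfFin hcard j) with ht_def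
  have hs : Function.Injective s := Subtype.val_injective.comp (S.orderIsoOfFin rfl).injective
  have ht : Function.Injective t := Subtype.val_injective.comp (T₀.orderIsoOfFin hcard).injective
  have hsS : Set.range s = ↑S := by
    rw [hs_def, Set.range_comp' Subtype.val, (S.orderIsoOfFin rfl).surjective.range_eq]
    simp
  have htT : Set.range t = ↑T₀ := by
    rw [ht_def, Set.range_comp' Subtype.val, (T₀.orderIsoOfFin hcard).surjective.range_eq]
    simp
  choose p hpR hhead hlast using hφ
  have heq : ∀ q ∈ R, ∀ q' ∈ R, ∀ v, v ∈ q → v ∈ q' → q = q' := fun q hq q' hq' v hv hv' =>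
    (hRdisj q hq q' hq').resolve_right fun h => h v hv hv'
  have hpinj : Function.Injective p := by
    intro i j hij
    have := hhead i
    rw [hij, hhead j] at this
    exact (hs (Option.some.inj this)).symm
  have hφinj : Function.Injective φ := by
    intro i j hij
    refine hpinj (heq _ (hpR i) _ (hpR j) _ (List.mem_of_mem_getLast? (hlast i)) ?_)
    rw [hij]
    exact List.mem_of_mem_getLast? (hlast j)
  obtain ⟨π, rfl⟩ : ∃ π : Equiv.Perm (Fin S.card), ⇑π = φ :=
    ⟨Equiv.ofBijective φ (Finite.injective_iff_bijective.1 hφinj), rfl⟩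
  have hp : IsPathFamily A s t π p := by
    refine ⟨fun i => hRpath _ (hpR i), hhead, hlast, fun i j hij v hv hv' => ?_⟩
    exact hij (hpinj (heq _ (hpR i) _ (hpR j) v hv hv'))
  obtain rfl : R = Set.range p := by
    refine Set.Subset.antisymm (fun q hq => ?_) (Set.range_subset_iff.2 hpR)
    obtain ⟨y, hy, hqy⟩ := hRend q hq
    rw [← htT] at hy
    obtain ⟨j, rfl⟩ := hy
    obtain ⟨i, rfl⟩ := π.surjective j
    exact ⟨i, heq _ (hpR i) _ hq _ (List.mem_of_mem_getLast? (hlast i))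
      (List.mem_of_mem_getLast? hqy)⟩
  change Real.sign (Matrix.of fun i j => pathMatrix A w (s i) (t j)).det = _
  rw [sign_det_pathMatrix_of_greatest hacyclic hr hw ht hp fun π' p' hp' hne =>
    hRmax _ (hp'.isRouting hsS htT) fun h => hne (hp'.eq_of_range_eq hp hs h),
    neg_one_pow_card_inversions, finprod_mem_range hpinj, finprod_eq_prod_of_fintype]
  rfl
end

section
/- Let D = (V,A) be a digraph, c a cycle in D, and x,t ∉ V distinct new vertices. Then every cycle of the lifting D^{(c)}_{(x,t)} is also a cycle of D, while c is a cycle of D that is not even a walk in D^{(c)}_{(x,t)}; consequently the number of cycles of D^{(c)}_{(x,t)} is strictly smaller than the number of cycles of D. -/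
theorem isWalk_iff_getElem {V : Type*} {A : Set (V × V)} {p : List V} :
    IsWalk A p ↔ p ≠ [] ∧ ∀ (i : ℕ) (h : i + 1 < p.length), (p[i], p[i + 1]) ∈ A :=
  and_congr_right fun _ => List.isChain_iff_getElem

theorem IsCycle.getElem_zero_eq {V : Type*} {A : Set (V × V)} {p : List V} (hp : IsCycle A p)
    {m : ℕ} (hm : p.length = m + 1) : p[0] = p[m] := by
  have h := hp.2.2.1
  rw [List.head?_eq_getElem?, List.getLast?_eq_getElem?, hm, Nat.add_sub_cancel,
    List.getElem?_eq_getElem (by omega), List.getElem?_eq_getElem (by omega)] at h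
  exact Option.some.inj h

/-- Every vertex of a cycle is entered by an arc. -/
theorem IsCycle.exists_arc_to {V : Type*} {A : Set (V × V)} {p : List V} (hp : IsCycle A p)
    {w : V} (hw : w ∈ p) : ∃ a, (a, w) ∈ A := by
  obtain ⟨-, harc⟩ := isWalk_iff_getElem.1 hp.1
  obtain ⟨m, hm⟩ : ∃ m, p.length = m + 2 := ⟨p.length - 2, by have := hp.2.1; omega⟩
  obtain ⟨i, hi, rfl⟩ := List.getElem_of_mem hw
  cases i with
  | zero => exact ⟨p[m], hp.getElem_zero_eq hm ▸ harc m (by omega)⟩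
  | succ i => exact ⟨p[i], harc i hi⟩

/-- Every vertex of a cycle is left by an arc. -/
theorem IsCycle.exists_arc_from {V : Type*} {A : Set (V × V)} {p : List V} (hp : IsCycle A p)
    {w : V} (hw : w ∈ p) : ∃ b, (w, b) ∈ A := by
  obtain ⟨-, harc⟩ := isWalk_iff_getElem.1 hp.1
  obtain ⟨m, hm⟩ : ∃ m, p.length = m + 2 := ⟨p.length - 2, by have := hp.2.1; omega⟩
  obtain ⟨i, hi, rfl⟩ := List.getElem_of_mem hw
  by_cases h : i + 1 < p.length
  · exact ⟨p[i + 1], harc i h⟩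
  · obtain rfl : i = m + 1 := by omega
    exact ⟨p[1], hp.getElem_zero_eq hm ▸ harc 0 (by omega)⟩

/-- A cycle is a cycle with respect to any arc set containing its arcs. -/
theorem IsCycle.of_isWalk {V : Type*} {A B : Set (V × V)} {p : List V} (hp : IsCycle B p)
    (hw : IsWalk A p) : IsCycle A p :=
  ⟨hw, hp.2.1, hp.2.2.1, ⟨hp.2.2.2.1.1, hw.2.prefix p.dropLast_prefix⟩, hp.2.2.2.2⟩

/-- A digraph with finitely many vertices has finitely many cycles. -/
theorem finite_setOf_isCycle {V : Type*} {S : Set V} (hS : S.Finite) {A : Set (V × V)}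
    (hA : ∀ a ∈ A, a.1 ∈ S ∧ a.2 ∈ S) : {p | IsCycle A p}.Finite := by
  have := hS.fintype
  refine ((List.finite_length_le S (Fintype.card S + 1)).image
    (List.map Subtype.val)).subset fun p hp => ?_
  have hmem : ∀ w ∈ p, w ∈ S := fun w hw =>
    have ⟨_, hb⟩ := hp.exists_arc_from hw
    (hA _ hb).1
  lift p to List S using hmem
  refine ⟨p, ?_, rfl⟩
  have hnd : p.dropLast.Nodup := by
    have := hp.2.2.2.2
    rw [← List.map_dropLast] at this
    exact this.of_map _
  have := hnd.length_le_card
  rw [List.length_dropLast] at this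
  exact Nat.sub_le_iff_le_add.1 this

/-- Lifting a cycle strictly decreases the number of cycles: every cycle of the lifting
`D^{(c)}_{(x,t)}` is a cycle of `D`, the lifted cycle `c` is no longer even a walk, and the
number of cycles strictly decreases. -/
theorem lifting_decreases_cycles {α : Type*} (Vset : Set α) (hV : Vset.Finite)
    (A : Set (α × α)) (hA : ∀ a ∈ A, a.1 ∈ Vset ∧ a.2 ∈ Vset)
    (u v : α) (rest : List α) (hcyc : IsCycle A (u :: v :: rest))
    (x t : α) (hx : x ∉ Vset) (ht : t ∉ Vset) (hxt : x ≠ t) :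
    (∀ p, IsCycle (liftArcs A u v x t) p → IsCycle A p) ∧
    ¬ IsWalk (liftArcs A u v x t) (u :: v :: rest) ∧
    {p | IsCycle (liftArcs A u v x t) p}.ncard < {p | IsCycle A p}.ncard := by
  have huv : (u, v) ∈ A := (List.isChain_cons_cons.1 hcyc.1.2).1
  obtain ⟨hu, hv⟩ := hA _ huv
  have not_to_x : ∀ a, (a, x) ∉ liftArcs A u v x t := by
    rintro a (⟨h, -⟩ | h | h | h)
    · exact hx (hA _ h).2
    · exact hxt (Prod.mk.inj h).2
    · exact hx ((Prod.mk.inj h).2 ▸ hv)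
    · exact hxt (Prod.mk.inj h).2
  have not_from_t : ∀ b, (t, b) ∉ liftArcs A u v x t := by
    rintro b (⟨h, -⟩ | h | h | h)
    · exact ht (hA _ h).1
    · exact ht ((Prod.mk.inj h).1 ▸ hu)
    · exact hxt (Prod.mk.inj h).1.symm
    · exact hxt (Prod.mk.inj h).1.symm
  have hsub : ∀ p, IsCycle (liftArcs A u v x t) p → IsCycle A p := by
    intro p hp
    obtain ⟨hne, harc⟩ := isWalk_iff_getElem.1 hp.1
    refine hp.of_isWalk (isWalk_iff_getElem.2 ⟨hne, fun i h => ?_⟩)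
    obtain ⟨a, ha⟩ := hp.exists_arc_to (List.getElem_mem (Nat.lt_of_succ_lt h))
    obtain ⟨b, hb⟩ := hp.exists_arc_from (List.getElem_mem h)
    rcases harc i h with ⟨h, -⟩ | h | h | h
    · exact h
    · exact absurd ((Prod.mk.inj h).2 ▸ hb) (not_from_t b)
    · exact absurd ((Prod.mk.inj h).1 ▸ ha) (not_to_x a)
    · exact absurd ((Prod.mk.inj h).1 ▸ ha) (not_to_x a)
  have hnot : ¬ IsWalk (liftArcs A u v x t) (u :: v :: rest) := by
    intro h
    rcases (List.isChain_cons_cons.1 h.2).1 with ⟨-, h⟩ | h | h | h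
    · exact h rfl
    · exact ht ((Prod.mk.inj h).2 ▸ hv)
    · exact hx ((Prod.mk.inj h).1 ▸ hu)
    · exact hx ((Prod.mk.inj h).1 ▸ hu)
  exact ⟨hsub, hnot, Set.ncard_lt_ncard
    ((Set.ssubset_iff_of_subset hsub).2 ⟨_, hcyc, fun h => hnot h.1⟩)
    (finite_setOf_isCycle hV hA)⟩
end

section
/- Every digraph D = (V,A) has a complete lifting: there exist n ∈ ℕ, pairwise distinct new vertices x₁,t₁,…,x_n,t_n ∉ V, and a sequence of digraphs D^{(0)}, D^{(1)}, …, D^{(n)} with D^{(0)} = D such that for each i ∈ {1,…,n}, D^{(i)} is the lifting of some cycle c_i of D^{(i-1)} by (x_i,t_i), and D^{(n)} is acyclic. -/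
/-- The last vertex of a walk with at least one arc is the head of an arc. -/
theorem exists_arc_to_getLast {W : Type*} {B : Set (W × W)} (u v : W) (l : List W)
    (h : (u :: v :: l).IsChain (fun a b => (a, b) ∈ B)) :
    ∃ a, (a, (v :: l).getLast (List.cons_ne_nil v l)) ∈ B := by
  induction l generalizing u v with
  | nil => exact ⟨u, by simpa using h⟩
  | cons w l ih =>
    rw [List.isChain_cons_cons] at h
    simpa using ih v w h.2

/-- The first vertex of a cycle is the head of an arc, the second one is the tail of an arc,
and the two are joined by an arc. -/
theorem IsCycle.arcs_of_cons_cons {W : Type*} {B : Set (W × W)} {u v : W} {l : List W}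
    (h : IsCycle B (u :: v :: l)) :
    (u, v) ∈ B ∧ (∃ a, (a, u) ∈ B) ∧ ∃ b, (v, b) ∈ B := by
  obtain ⟨⟨-, hc⟩, -, hl, -⟩ := h
  replace hc : (u :: v :: l).IsChain (fun a b => (a, b) ∈ B) := hc
  have huv : (u, v) ∈ B := (List.isChain_cons_cons.1 hc).1
  have hu : u = (v :: l).getLast (List.cons_ne_nil v l) := by
    simpa [List.getLast?_eq_getLast_of_ne_nil] using hl
  refine ⟨huv, ?_, ?_⟩
  · obtain ⟨a, ha⟩ := exists_arc_to_getLast u v l hc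
    exact ⟨a, hu ▸ ha⟩
  · cases l with
    | nil =>
      obtain rfl : u = v := by simpa using hu
      exact ⟨u, huv⟩
    | cons w l => exact ⟨w, (List.isChain_cons_cons.1 (List.isChain_cons_cons.1 hc).2).1⟩

/-- Every cycle has at least two entries. -/
theorem IsCycle.exists_eq_cons_cons {W : Type*} {B : Set (W × W)} {p : List W}
    (h : IsCycle B p) : ∃ u v l, p = u :: v :: l := by
  obtain ⟨-, hlen, -⟩ := h
  match p, hlen with
  | u :: v :: l, _ => exact ⟨u, v, l, rfl⟩

/-- The even new vertices are sources and the odd new vertices are sinks. -/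
def NewVerticesExtremal {V : Type*} (B : Set ((V ⊕ ℕ) × (V ⊕ ℕ))) : Prop :=
  ∀ a ∈ B, ∀ k, a.1 ≠ Sum.inr (2 * k + 1) ∧ a.2 ≠ Sum.inr (2 * k)

/-- The arcs of `B` between original vertices. -/
def originalArcs {V : Type*} (B : Set ((V ⊕ ℕ) × (V ⊕ ℕ))) : Set (V × V) :=
  {a | (Sum.inl a.1, Sum.inl a.2) ∈ B}

theorem NewVerticesExtremal.exists_eq_inl {V : Type*} {B : Set ((V ⊕ ℕ) × (V ⊕ ℕ))}
    (hB : NewVerticesExtremal B) {a b w : V ⊕ ℕ} (h₁ : (a, w) ∈ B) (h₂ : (w, b) ∈ B) :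
    ∃ x, w = Sum.inl x := by
  rcases w with x | j
  · exact ⟨x, rfl⟩
  · obtain ⟨k, rfl | rfl⟩ := Nat.even_or_odd' j
    · exact absurd rfl (hB _ h₁ k).2
    · exact absurd rfl (hB _ h₂ k).1

section Lift

variable {V : Type*} {B : Set ((V ⊕ ℕ) × (V ⊕ ℕ))} {u v : V ⊕ ℕ} {l : List (V ⊕ ℕ)}

theorem NewVerticesExtremal.exists_eq_inl_of_isCycle (hB : NewVerticesExtremal B)
    (hc : IsCycle B (u :: v :: l)) : ∃ x y, u = Sum.inl x ∧ v = Sum.inl y := by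
  obtain ⟨huv, ⟨a, ha⟩, b, hb⟩ := hc.arcs_of_cons_cons
  obtain ⟨x, hx⟩ := hB.exists_eq_inl ha huv
  obtain ⟨y, hy⟩ := hB.exists_eq_inl huv hb
  exact ⟨x, y, hx, hy⟩

theorem NewVerticesExtremal.liftArcs (hB : NewVerticesExtremal B)
    (hc : IsCycle B (u :: v :: l)) (k : ℕ) :
    NewVerticesExtremal (liftArcs B u v (Sum.inr (2 * k)) (Sum.inr (2 * k + 1))) := by
  obtain ⟨x, y, rfl, rfl⟩ := hB.exists_eq_inl_of_isCycle hc
  rintro a (⟨ha, -⟩ | rfl | rfl | rfl) j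
  · exact hB a ha j
  all_goals
    constructor <;> simp <;> omega

/-- Lifting a cycle destroys an arc between original vertices. -/
theorem NewVerticesExtremal.ncard_originalArcs_liftArcs_lt [Finite V]
    (hB : NewVerticesExtremal B) (hc : IsCycle B (u :: v :: l)) (j k : ℕ) :
    (originalArcs (_root_.liftArcs B u v (Sum.inr j) (Sum.inr k))).ncard <
      (originalArcs B).ncard := by
  obtain ⟨x, y, rfl, rfl⟩ := hB.exists_eq_inl_of_isCycle hc
  refine Set.ncard_lt_ncard ⟨?_, fun hsub => ?_⟩ (Set.toFinite _)
  · rintro a (⟨ha, -⟩ | ha | ha | ha)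
    · exact ha
    all_goals simp at ha
  · have hxy : (x, y) ∈ originalArcs B := hc.arcs_of_cons_cons.1
    simpa [originalArcs, _root_.liftArcs] using hsub hxy

end Lift

/-- Every digraph has a complete lifting: a sequence of cycle liftings by pairwise distinct
new vertices ending in an acyclic digraph. -/
theorem exists_complete_lifting {V : Type*} [Fintype V] (A : Set (V × V)) :
    ∃ (n : ℕ) (xs ts : Fin n → V ⊕ ℕ)
      (As : Fin (n + 1) → Set ((V ⊕ ℕ) × (V ⊕ ℕ))),
      Function.Injective (fun p : Fin n × Bool => if p.2 then xs p.1 else ts p.1) ∧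
      (∀ i, xs i ∉ Set.range (Sum.inl : V → V ⊕ ℕ) ∧
            ts i ∉ Set.range (Sum.inl : V → V ⊕ ℕ)) ∧
      As 0 = {a | ∃ b ∈ A, a = (Sum.inl b.1, Sum.inl b.2)} ∧
      (∀ i : Fin n, ∃ (u v : V ⊕ ℕ) (rest : List (V ⊕ ℕ)),
        IsCycle (As i.castSucc) (u :: v :: rest) ∧
        As i.succ = liftArcs (As i.castSucc) u v (xs i) (ts i)) ∧
      (∀ p, ¬ IsCycle (As (Fin.last n)) p) := by
  have step : ∀ (k : ℕ) (B : Set ((V ⊕ ℕ) × (V ⊕ ℕ))), ∃ B', (∃ p, IsCycle B p) →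
      ∃ u v rest, IsCycle B (u :: v :: rest) ∧
        B' = liftArcs B u v (Sum.inr (2 * k)) (Sum.inr (2 * k + 1)) := by
    intro k B
    by_cases h : ∃ p, IsCycle B p
    · obtain ⟨p, hp⟩ := h
      obtain ⟨u, v, l, rfl⟩ := hp.exists_eq_cons_cons
      exact ⟨_, fun _ => ⟨u, v, l, hp, rfl⟩⟩
    · exact ⟨B, fun h' => absurd h' h⟩
  choose next hnext using step
  let f : ℕ → Set ((V ⊕ ℕ) × (V ⊕ ℕ)) := fun k =>
    Nat.rec {a | ∃ b ∈ A, a = (Sum.inl b.1, Sum.inl b.2)} next k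
  have hf : ∀ k, (∃ p, IsCycle (f k) p) → ∃ u v rest, IsCycle (f k) (u :: v :: rest) ∧
      f (k + 1) = liftArcs (f k) u v (Sum.inr (2 * k)) (Sum.inr (2 * k + 1)) :=
    fun k => hnext k (f k)
  have hacyc : ∃ n, ¬ ∃ p, IsCycle (f n) p := by
    by_contra! hcyc
    have key : ∀ k, NewVerticesExtremal (f k) ∧
        (originalArcs (f k)).ncard + k ≤ (originalArcs (f 0)).ncard := by
      intro k
      induction k with
      | zero =>
        refine ⟨?_, le_rfl⟩
        rintro _ ⟨b, -, rfl⟩ k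
        simp
      | succ k ih =>
        obtain ⟨u, v, l, hc, hk⟩ := hf k (hcyc k)
        rw [hk]
        refine ⟨ih.1.liftArcs hc k, ?_⟩
        have := ih.1.ncard_originalArcs_liftArcs_lt hc (2 * k) (2 * k + 1)
        omega
    have := (key ((originalArcs (f 0)).ncard + 1)).2
    omega
  classical
  refine ⟨Nat.find hacyc, fun i => Sum.inr (2 * i), fun i => Sum.inr (2 * i + 1),
    fun i => f i, ?_, fun i => by simp, rfl, fun i => ?_, fun p hp => ?_⟩
  · rintro ⟨i, _ | _⟩ ⟨j, _ | _⟩ h <;> simp [Fin.ext_iff] at h ⊢ <;> omega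
  · exact hf i (not_not.1 (Nat.find_min hacyc i.2))
  · exact Nat.find_spec hacyc ⟨p, hp⟩
end

section
/- Let D = (V,A) be a digraph, E, T ⊆ V, c a cycle in D, x,t ∉ V distinct new vertices, and D' = D^{(c)}_{(x,t)} the lifting of c in D by (x,t). Then Γ(D,T,E) equals the contraction of Γ(D',T∪{t},E∪{x}) by {x}, i.e., Γ(D,T,E) = Γ(D',T∪{t},E∪{x}) . E. -/
section Routings

variable {V : Type*} {A B : Set (V × V)} {R S : Set (List V)} {X Y Z W : Set V}

lemma IsPath.of_arcs {p : List V} (hp : IsPath A p)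
    (h : ∀ a ∈ p, ∀ b ∈ p, (a, b) ∈ A → (a, b) ∈ B) : IsPath B p :=
  ⟨⟨hp.1.1, List.IsChain.imp_of_mem_imp (fun a b ha hb hab => h a ha b hb hab) hp.1.2⟩, hp.2⟩

lemma isPath_singleton (a : V) : IsPath A [a] :=
  ⟨⟨by simp, List.isChain_singleton a⟩, by simp⟩

lemma isPath_append_cons_cons {a b : V} {l₁ l₂ : List V} :
    IsPath A (l₁ ++ a :: b :: l₂) ↔
      IsPath A (l₁ ++ [a]) ∧ (a, b) ∈ A ∧ IsPath A (b :: l₂) ∧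
        ∀ w ∈ l₁ ++ [a], w ∉ b :: l₂ := by
  have hn : (l₁ ++ a :: b :: l₂).Nodup ↔
      (l₁ ++ [a]).Nodup ∧ (b :: l₂).Nodup ∧ ∀ w ∈ l₁ ++ [a], w ∉ b :: l₂ := by
    rw [show l₁ ++ a :: b :: l₂ = (l₁ ++ [a]) ++ b :: l₂ by simp, List.nodup_append']
    rfl
  have hc := List.isChain_append_cons_cons (R := fun u v => (u, v) ∈ A) (b := a) (c := b)
    (l₁ := l₁) (l₂ := l₂)
  unfold IsPath IsWalk List.Chain'
  rw [hn, hc]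
  simp only [ne_eq, List.append_eq_nil_iff, reduceCtorEq, and_false, not_false_eq_true, true_and]
  tauto

lemma IsPath.of_forall_ne {p : List V} {u v : V} (hp : IsPath A p)
    (h : ∀ l₁ l₂, p ≠ l₁ ++ u :: v :: l₂) : IsPath (A \ {(u, v)}) p := by
  refine ⟨⟨hp.1.1, ?_⟩, hp.2⟩
  refine List.isChain_iff_forall_rel_of_append_cons_cons.2 fun a b l₁ l₂ hl => ?_
  refine ⟨List.isChain_iff_forall_rel_of_append_cons_cons.1 hp.1.2 hl, fun hab => ?_⟩
  obtain ⟨rfl, rfl⟩ := Prod.mk.inj hab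
  exact h _ _ hl

lemma IsPath.exists_eq_cons_of_no_arc_into {p : List V} {x : V} (hp : IsPath A p)
    (h : ∀ a, (a, x) ∉ A) (hx : x ∈ p) : ∃ l, p = x :: l := by
  obtain ⟨l₁, l₂, rfl⟩ := List.append_of_mem hx
  rcases l₁.eq_nil_or_concat with rfl | ⟨l, a, rfl⟩
  · exact ⟨l₂, rfl⟩
  · rw [List.concat_eq_append, List.append_assoc] at hp
    exact absurd (isPath_append_cons_cons.1 hp).2.1 (h a)

lemma IsPath.exists_eq_concat_of_no_arc_from {p : List V} {t : V} (hp : IsPath A p)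
    (h : ∀ a, (t, a) ∉ A) (ht : t ∈ p) : ∃ l, p = l ++ [t] := by
  obtain ⟨l₁, l₂, rfl⟩ := List.append_of_mem ht
  cases l₂ with
  | nil => exact ⟨l₁, rfl⟩
  | cons a l => exact absurd (isPath_append_cons_cons.1 hp).2.1 (h a)

lemma IsPath.subset_of_getLast_mem {p : List V} {y : V} (hp : IsPath A p)
    (hA : ∀ a ∈ A, a.1 ∈ W) (hy : p.getLast? = some y) (hyW : y ∈ W) : ∀ w ∈ p, w ∈ W := by
  intro w hw
  obtain ⟨l₁, l₂, rfl⟩ := List.append_of_mem hw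
  cases l₂ with
  | nil => simp_all
  | cons a l => exact hA _ (isPath_append_cons_cons.1 hp).2.1

lemma IsRouting.mono (h : IsRouting A R X Y) (hX : Z ⊆ X) (hY : Y ⊆ W) : IsRouting A R Z W :=
  ⟨h.1, fun x hx => h.2.1 x (hX hx),
    fun p hp => (h.2.2.1 p hp).imp fun _ hy => ⟨hY hy.1, hy.2⟩, h.2.2.2⟩

lemma IsRouting.of_subset (h : IsRouting A R X Y) (hS : S ⊆ R) (hB : ∀ p ∈ S, IsPath B p)
    (hZ : ∀ z ∈ Z, ∃ p ∈ S, p.head? = some z)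
    (hW : ∀ p ∈ S, ∀ y ∈ Y, p.getLast? = some y → y ∈ W) : IsRouting B S Z W := by
  refine ⟨hB, hZ, fun p hp => ?_, fun p hp q hq => h.2.2.2 p (hS hp) q (hS hq)⟩
  obtain ⟨y, hy, hpy⟩ := h.2.2.1 p (hS hp)
  exact ⟨y, hW p hp y hy hpy, hpy⟩

lemma IsRouting.insert {r : List V} {s y : V} (h : IsRouting A R X Y) (hr : IsPath A r)
    (hs : r.head? = some s) (hy : r.getLast? = some y) (hyY : y ∈ Y)
    (hd : ∀ q ∈ R, ∀ w ∈ r, w ∉ q) :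
    IsRouting A (insert r R) (insert s X) Y := by
  refine ⟨?_, ?_, ?_, ?_⟩
  · rintro p (rfl | hp)
    exacts [hr, h.1 p hp]
  · rintro w (rfl | hw)
    · exact ⟨r, Or.inl rfl, hs⟩
    · obtain ⟨p, hp, hpw⟩ := h.2.1 w hw
      exact ⟨p, Or.inr hp, hpw⟩
  · rintro p (rfl | hp)
    exacts [⟨y, hyY, hy⟩, h.2.2.1 p hp]
  · rintro p (rfl | hp) q (rfl | hq)
    · exact Or.inl rfl
    · exact Or.inr (hd q hq)
    · exact Or.inr fun w hw hw' => hd p hp w hw' hw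
    · exact h.2.2.2 p hp q hq

lemma IsRouting.eq_of_mem {p q : List V} {w : V} (h : IsRouting A R X Y) (hp : p ∈ R)
    (hq : q ∈ R) (hwp : w ∈ p) (hwq : w ∈ q) : p = q :=
  (h.2.2.2 p hp q hq).resolve_right fun hd => hd w hwp hwq

end Routings

section Lifting

variable {V : Type*} {A : Set (V × V)} {X T W : Set V} {u v x t : V}

lemma HasRouting.to_liftArcs (hA : ∀ a ∈ A, a.1 ∈ W ∧ a.2 ∈ W) (hT : T ⊆ W)
    (hx : x ∉ W) (ht : t ∉ W) (hxt : x ≠ t) (h : HasRouting A X T) :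
    HasRouting (liftArcs A u v x t) (X ∪ {x}) (T ∪ {t}) := by
  obtain ⟨R, hR⟩ := h
  have hW : ∀ p ∈ R, ∀ w ∈ p, w ∈ W := by
    intro p hp
    obtain ⟨y, hy, hpy⟩ := hR.2.2.1 p hp
    exact (hR.1 p hp).subset_of_getLast_mem (fun a ha => (hA a ha).1) hpy (hT hy)
  have hxR : ∀ p ∈ R, x ∉ p := fun p hp hxp => hx (hW p hp x hxp)
  have htR : ∀ p ∈ R, t ∉ p := fun p hp htp => ht (hW p hp t htp)
  by_cases huse : ∃ p ∈ R, ∃ l₁ l₂, p = l₁ ++ u :: v :: l₂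
  · obtain ⟨_, hp, l₁, l₂, rfl⟩ := huse
    set p := l₁ ++ u :: v :: l₂ with hpdef
    obtain ⟨h₁, huv, h₂, hd⟩ := isPath_append_cons_cons.1 (hR.1 p hp)
    obtain ⟨y, hy, hpy⟩ := hR.2.2.1 p hp
    have hdp : ∀ q ∈ R \ {p}, ∀ w ∈ p, w ∉ q := fun q hq w hw hwq =>
      hq.2 (hR.eq_of_mem hq.1 hp hwq hw)
    have hS : IsRouting (liftArcs A u v x t) (R \ {p}) (X \ {w | p.head? = some w})
        (T ∪ {t}) := by
      refine hR.of_subset Set.sdiff_subset (fun q hq => (hR.1 q hq.1).of_arcs ?_) ?_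
        fun q hq y hy _ => Or.inl hy
      · rintro a ha b - hab
        refine Or.inl ⟨hab, fun hab' => ?_⟩
        obtain ⟨rfl, rfl⟩ := Prod.mk.inj hab'
        exact hdp q hq a (by simp [hpdef]) ha
      · rintro z ⟨hz, hzp⟩
        obtain ⟨q, hq, hqz⟩ := hR.2.1 z hz
        exact ⟨q, ⟨hq, by rintro rfl; exact hzp hqz⟩, hqz⟩
    obtain ⟨s, hs⟩ : ∃ s, (l₁ ++ [u, t]).head? = some s := by cases l₁ <;> simp
    have hps : p.head? = some s := by cases l₁ <;> simpa [hpdef] using hs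
    have hfst : IsPath (liftArcs A u v x t) (l₁ ++ [u, t]) := by
      refine isPath_append_cons_cons.2 ⟨h₁.of_arcs ?_, ?_, isPath_singleton t, ?_⟩
      · rintro a - b hb hab
        refine Or.inl ⟨hab, fun hab' => ?_⟩
        obtain ⟨rfl, rfl⟩ := Prod.mk.inj hab'
        exact hd _ hb (by simp)
      · simp [liftArcs]
      · intro w hw hwt
        obtain rfl := List.mem_singleton.1 hwt
        exact htR p hp (by simp only [hpdef, List.mem_append, List.mem_cons] at hw ⊢; tauto)
    have hsnd : IsPath (liftArcs A u v x t) ([] ++ x :: v :: l₂) := by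
      refine isPath_append_cons_cons.2 ⟨isPath_singleton x, ?_, h₂.of_arcs ?_, ?_⟩
      · simp [liftArcs]
      · rintro a ha b - hab
        refine Or.inl ⟨hab, fun hab' => ?_⟩
        obtain ⟨rfl, rfl⟩ := Prod.mk.inj hab'
        exact hd a (by simp) ha
      · intro w hw hwt
        obtain rfl := List.mem_singleton.1 hw
        exact hxR p hp (by simp only [hpdef, List.mem_append, List.mem_cons] at hwt ⊢; tauto)
    have hfstR : ∀ q ∈ R \ {p}, ∀ w ∈ l₁ ++ [u, t], w ∉ q := by
      intro q hq w hw hwq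
      by_cases hwt : w = t
      · exact htR q hq.1 (hwt ▸ hwq)
      · refine hdp q hq w ?_ hwq
        simp only [hpdef, List.mem_append, List.mem_cons, List.not_mem_nil, or_false] at hw ⊢
        tauto
    have hsndR : ∀ q ∈ insert (l₁ ++ [u, t]) (R \ {p}), ∀ w ∈ x :: v :: l₂, w ∉ q := by
      rintro q (rfl | hq) w hw hwq
      · rcases List.mem_cons.1 hw with rfl | hw
        · refine hxR p hp ?_
          simp only [hpdef, List.mem_append, List.mem_cons, List.not_mem_nil, or_false] at hwq ⊢
          tauto
        · by_cases hwt : w = t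
          · subst hwt
            exact htR p hp (by simp only [hpdef, List.mem_append, List.mem_cons] at hw ⊢; tauto)
          · refine hd w ?_ hw
            simp only [List.mem_append, List.mem_cons, List.not_mem_nil, or_false] at hwq ⊢
            tauto
      · rcases List.mem_cons.1 hw with rfl | hw
        · exact hxR q hq.1 hwq
        · refine hdp q hq w ?_ hwq
          simp only [hpdef, List.mem_append, List.mem_cons] at hw ⊢
          tauto
    refine ⟨_, ((hS.insert hfst hs (y := t) (by simp) (by simp) hfstR).insert hsnd rfl (y := y) ?_
      (Or.inl hy) hsndR).mono ?_ subset_rfl⟩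
    · simpa [hpdef, List.getLast?_append, List.getLast?_cons_cons] using hpy
    · rintro z (hz | rfl)
      · by_cases hzs : z = s
        · exact Or.inr (Or.inl hzs)
        · exact Or.inr (Or.inr ⟨hz, fun hz' => hzs (Option.some.inj (hz'.symm.trans hps))⟩)
      · exact Or.inl rfl
  · push Not at huse
    have hS : IsRouting (liftArcs A u v x t) R X (T ∪ {t}) :=
      hR.of_subset subset_rfl (fun q hq => ((hR.1 q hq).of_forall_ne (huse q hq)).of_arcs
        fun _ _ _ _ hab => Or.inl hab) hR.2.1 fun q hq y hy _ => Or.inl hy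
    refine ⟨_, (hS.insert (r := [x, t]) (s := x) (y := t) ?_ rfl rfl (by simp) ?_).mono ?_
      subset_rfl⟩
    · refine (isPath_append_cons_cons (l₁ := [])).2
        ⟨isPath_singleton x, ?_, isPath_singleton t, ?_⟩
      · simp [liftArcs]
      · simpa using hxt
    · intro q hq w hw
      simp only [List.mem_cons, List.not_mem_nil, or_false] at hw
      rcases hw with rfl | rfl
      exacts [hxR q hq, htR q hq]
    · rintro z (hz | rfl)
      exacts [Or.inr hz, Or.inl rfl]

lemma HasRouting.of_liftArcs (hA : ∀ a ∈ A, a.1 ∈ W ∧ a.2 ∈ W) (hT : T ⊆ W) (hX : X ⊆ W)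
    (huv : (u, v) ∈ A) (hx : x ∉ W) (ht : t ∉ W) (hxt : x ≠ t)
    (h : HasRouting (liftArcs A u v x t) (X ∪ {x}) (T ∪ {t})) : HasRouting A X T := by
  obtain ⟨R, hR⟩ := h
  obtain ⟨hu, hv⟩ : u ∈ W ∧ v ∈ W := hA _ huv
  have hinto : ∀ a, (a, x) ∉ liftArcs A u v x t := by
    rintro a (⟨h, -⟩ | h | h | h)
    · exact hx (hA _ h).2
    · exact hxt (Prod.mk.inj h).2
    · exact hx ((Prod.mk.inj h).2 ▸ hv)
    · exact hxt (Prod.mk.inj h).2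
  have hfrom : ∀ a, (t, a) ∉ liftArcs A u v x t := by
    rintro a (⟨h, -⟩ | h | h | h)
    · exact ht (hA _ h).1
    · exact ht ((Prod.mk.inj h).1 ▸ hu)
    · exact hxt (Prod.mk.inj h).1.symm
    · exact hxt (Prod.mk.inj h).1.symm
  have hfromx : ∀ a, (x, a) ∈ liftArcs A u v x t → a = v ∨ a = t := by
    rintro a (⟨h, -⟩ | h | h | h)
    · exact absurd (hA _ h).1 hx
    · exact absurd ((Prod.mk.inj h).1 ▸ hu) hx
    · exact Or.inl (Prod.mk.inj h).2
    · exact Or.inr (Prod.mk.inj h).2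
  have hintot : ∀ a, (a, t) ∈ liftArcs A u v x t → a = u ∨ a = x := by
    rintro a (⟨h, -⟩ | h | h | h)
    · exact absurd (hA _ h).2 ht
    · exact Or.inl (Prod.mk.inj h).1
    · exact absurd ((Prod.mk.inj h).2 ▸ hv) ht
    · exact Or.inr (Prod.mk.inj h).1
  have hdown : ∀ q : List V, IsPath (liftArcs A u v x t) q → x ∉ q → t ∉ q →
      IsPath A q := by
    intro q hq hxq htq
    refine hq.of_arcs ?_
    rintro a ha b hb (h | h | h | h)
    · exact h.1
    · exact absurd ((Prod.mk.inj h).2 ▸ hb) htq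
    · exact absurd ((Prod.mk.inj h).1 ▸ ha) hxq
    · exact absurd ((Prod.mk.inj h).1 ▸ ha) hxq
  have hS : ∀ Z ⊆ X, (∀ z ∈ Z, ∀ q ∈ R, q.head? = some z → t ∉ q) →
      IsRouting A {q ∈ R | x ∉ q ∧ t ∉ q} Z T := by
    intro Z hZ hZt
    refine hR.of_subset (Set.sep_subset _ _)
      (fun q hq => hdown q (hR.1 q hq.1) hq.2.1 hq.2.2) ?_ ?_
    · intro z hz
      obtain ⟨q, hq, hqz⟩ := hR.2.1 z (Or.inl (hZ hz))
      refine ⟨q, ⟨hq, fun hxq => ?_, hZt z hz q hq hqz⟩, hqz⟩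
      obtain ⟨l, rfl⟩ := (hR.1 q hq).exists_eq_cons_of_no_arc_into hinto hxq
      exact hx (Option.some.inj hqz ▸ hX (hZ hz))
    · rintro q hq y (hy | rfl) hqy
      · exact hy
      · exact absurd (List.mem_of_getLast? hqy) hq.2.2
  by_cases huse : ∃ z ∈ X, ∃ p ∈ R, p.head? = some z ∧ t ∈ p
  · obtain ⟨z, hz, p, hp, hpz, htp⟩ := huse
    obtain ⟨q, hq, hqx⟩ := hR.2.1 x (Or.inr rfl)
    have hzx : z ≠ x := by rintro rfl; exact hx (hX hz)
    have hzt : z ≠ t := by rintro rfl; exact ht (hX hz)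
    have hpq : p ≠ q := by
      rintro rfl
      exact hzx (Option.some.inj (hpz.symm.trans hqx))
    have hxq : x ∈ q := List.mem_of_head? hqx
    have hxp : x ∉ p := fun hxp => hpq (hR.eq_of_mem hp hq hxp hxq)
    have htq : t ∉ q := fun htq => hpq (hR.eq_of_mem hp hq htp htq)
    obtain ⟨l, rfl⟩ := (hR.1 p hp).exists_eq_concat_of_no_arc_from hfrom htp
    rcases l.eq_nil_or_concat with rfl | ⟨l₁, u', rfl⟩
    · exact absurd (Option.some.inj hpz).symm hzt
    rw [List.concat_eq_append, List.append_assoc] at hp hpz hpq hxp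
    obtain ⟨h₁, hut, -, hd₁⟩ := isPath_append_cons_cons.1 (hR.1 _ hp)
    obtain rfl : u' = u := (hintot u' hut).resolve_right (by rintro rfl; simp at hxp)
    obtain ⟨m, rfl⟩ := (hR.1 q hq).exists_eq_cons_of_no_arc_into hinto hxq
    obtain ⟨y, hy, hqy⟩ := hR.2.2.1 _ hq
    have hyT : y ∈ T := hy.resolve_right (by rintro rfl; exact htq (List.mem_of_getLast? hqy))
    cases m with
    | nil =>
      obtain rfl : x = y := by simpa using hqy
      exact absurd (hT hyT) hx
    | cons v' l₂ =>
    obtain ⟨-, hxv, h₂, hd₂⟩ := (isPath_append_cons_cons (l₁ := [])).1 (hR.1 _ hq)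
    obtain rfl : v' = v := (hfromx v' hxv).resolve_right (by rintro rfl; simp at htq)
    have hpsub : ∀ w ∈ l₁ ++ [u'], w ∈ l₁ ++ ([u'] ++ [t]) := by
      intro w hw
      rw [← List.append_assoc]
      exact List.mem_append_left _ hw
    have hnew : IsPath A (l₁ ++ u' :: v' :: l₂) := by
      refine isPath_append_cons_cons.2 ⟨hdown _ h₁ (fun h => hxp (hpsub _ h))
        (fun h => hd₁ t h (by simp)), huv, hdown _ h₂ (hd₂ x (by simp))
        (fun h => htq (List.mem_cons_of_mem _ h)), fun w hw hw' => ?_⟩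
      exact hpq (hR.eq_of_mem hp hq (hpsub w hw) (List.mem_cons_of_mem _ hw'))
    have hbase : IsRouting A {q ∈ R | x ∉ q ∧ t ∉ q} (X \ {z}) T := by
      refine hS _ Set.sdiff_subset fun z' hz' q' hq' hqz' htq' => hz'.2 ?_
      obtain rfl := hR.eq_of_mem hq' hp htq' (by simp)
      exact Option.some.inj (hqz'.symm.trans hpz)
    refine ⟨_, (hbase.insert hnew (s := z) (y := y) ?_ ?_ hyT ?_).mono ?_ subset_rfl⟩
    · cases l₁ <;> simpa using hpz
    · simpa [List.getLast?_append, List.getLast?_cons_cons] using hqy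
    · rintro q' ⟨hq', hxq', htq'⟩ w hw hwq'
      rw [show l₁ ++ u' :: v' :: l₂ = (l₁ ++ [u']) ++ v' :: l₂ by simp, List.mem_append] at hw
      rcases hw with hw | hw
      · obtain rfl := hR.eq_of_mem hq' hp hwq' (hpsub w hw)
        exact htq' (by simp)
      · obtain rfl := hR.eq_of_mem hq' hq hwq' (List.mem_cons_of_mem _ hw)
        exact hxq' (by simp)
    · intro w hw
      by_cases hwz : w = z
      exacts [Or.inl hwz, Or.inr ⟨hw, hwz⟩]
  · push Not at huse
    exact ⟨_, hS X subset_rfl huse⟩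

end Lifting

/-- Lifting a cycle yields a quotient representation: `Γ(D,T,E)` equals the contraction of
`Γ(D',T∪{t},E∪{x})` to `E` (i.e. contracting `{x}`), where `D' = D^{(c)}_{(x,t)}`. -/
theorem lifting_contraction {α : Type*} (Vset : Set α) (hV : Vset.Finite)
    (A : Set (α × α)) (hA : ∀ a ∈ A, a.1 ∈ Vset ∧ a.2 ∈ Vset)
    (T E : Set α) (hT : T ⊆ Vset) (hE : E ⊆ Vset)
    (u v : α) (rest : List α) (hcyc : IsCycle A (u :: v :: rest))
    (x t : α) (hx : x ∉ Vset) (ht : t ∉ Vset) (hxt : x ≠ t) :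
    ∀ X, X ⊆ E →
      (GammoidIndep A T E X ↔
        ContractIndep (GammoidIndep (liftArcs A u v x t) (T ∪ {t}) (E ∪ {x})) {x} X) := by
  intro X hXE
  have huv : (u, v) ∈ A := List.IsChain.rel_head? hcyc.1.2 rfl
  have hind : GammoidIndep (liftArcs A u v x t) (T ∪ {t}) (E ∪ {x}) {x} := by
    refine ⟨Set.subset_union_right, ?_⟩
    have h : HasRouting A (∅ : Set α) T := ⟨∅, by simp [IsRouting]⟩
    simpa using h.to_liftArcs (u := u) (v := v) hA hT hx ht hxt
  constructor
  · rintro ⟨-, h⟩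
    exact ⟨{x}, subset_rfl, hind, fun J hJ hJ' _ => hJ'.antisymm hJ,
      Set.union_subset_union_left _ hXE, h.to_liftArcs hA hT hx ht hxt⟩
  · rintro ⟨I, hI, -, hmax, -, h⟩
    obtain rfl := hmax {x} hI subset_rfl hind
    exact ⟨hXE, h.of_liftArcs hA hT (hXE.trans hE) huv hx ht hxt⟩
end

section
/- Let M be a gammoid on ground set E. Then there exist an acyclic digraph D = (V,A) and sets T, E' ⊆ V with E ⊆ E' such that M = Γ(D,T,E') . E (the contraction of Γ(D,T,E') to E, i.e., contracting E'\E) and |T| = rk_M(E) + |E'\E|. -/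
theorem HasRouting.mono {V : Type*} {A : Set (V × V)} {X Y T : Set V} (h : HasRouting A Y T)
    (hXY : X ⊆ Y) : HasRouting A X T := by
  obtain ⟨R, hR, hY, hT, hd⟩ := h
  exact ⟨R, hR, fun x hx => hY x (hXY hx), hT, hd⟩

/-- A routing from `X` to `T` yields an injection of the complement of `T` into the complement
of `X` which moves every vertex along an arc or not at all. -/
theorem HasRouting.exists_injOn {V : Type*} {A : Set (V × V)} {X T : Set V}
    (h : HasRouting A X T) :
    ∃ φ : V → V, Set.InjOn φ Tᶜ ∧ ∀ v ∈ Tᶜ, φ v ∉ X ∧ (φ v = v ∨ (v, φ v) ∈ A) := by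
  classical
  obtain ⟨R, hR, hX, hT, hd⟩ := h
  have eq_of_mem : ∀ p ∈ R, ∀ q ∈ R, ∀ v, v ∈ p → v ∈ q → p = q := fun p hp q hq v hvp hvq =>
    (hd p hp q hq).resolve_right fun h => h v hvp hvq
  have succ : ∀ v : V, ∃ w : V, v ∈ Tᶜ →
      (∃ p ∈ R, ∃ i, ∃ h : i + 1 < p.length, p[i] = v ∧ p[i + 1] = w) ∨
      ((∀ p ∈ R, v ∉ p) ∧ w = v) := by
    intro v
    by_cases hv : ∃ p ∈ R, v ∈ p
    · obtain ⟨p, hp, hvp⟩ := hv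
      obtain ⟨i, hi, hiv⟩ := List.getElem_of_mem hvp
      by_cases hi' : i + 1 < p.length
      · exact ⟨p[i + 1], fun _ => Or.inl ⟨p, hp, i, hi', hiv, rfl⟩⟩
      · refine ⟨v, fun hvT => absurd ?_ hvT⟩
        obtain ⟨y, hy, hpy⟩ := hT p hp
        rw [List.getLast?_eq_getElem?, show p.length - 1 = i by omega,
          List.getElem?_eq_getElem hi, hiv] at hpy
        cases hpy
        exact hy
    · push Not at hv
      exact ⟨v, fun _ => Or.inr ⟨hv, rfl⟩⟩
  choose φ hφ using succ
  refine ⟨φ, ?_, ?_⟩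
  · intro u hu v hv huv
    rcases hφ u hu with ⟨p, hp, i, hi, hpu, hpi⟩ | ⟨hu', hu''⟩ <;>
    rcases hφ v hv with ⟨q, hq, j, hj, hqv, hqj⟩ | ⟨hv', hv''⟩
    · have hpq := eq_of_mem p hp q hq (φ u) (hpi ▸ List.getElem_mem hi)
        (huv ▸ hqj ▸ List.getElem_mem hj)
      subst hpq
      have := (hR p hp).2.getElem_inj_iff.1 ((hpi.trans huv).trans hqj.symm)
      obtain rfl : i = j := by omega
      exact hpu.symm.trans hqv
    · exact absurd (hpi ▸ List.getElem_mem hi) (huv ▸ hv''.symm ▸ hv' p hp)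
    · exact absurd (hqj ▸ List.getElem_mem hj) (huv ▸ hu''.symm ▸ hu' q hq)
    · exact hu''.symm.trans (huv.trans hv'')
  · intro v hv
    rcases hφ v hv with ⟨p, hp, i, hi, hpv, hpi⟩ | ⟨hv', hv''⟩
    · refine ⟨fun hX' => ?_, Or.inr ?_⟩
      · obtain ⟨q, hq, hqh⟩ := hX _ hX'
        have hpq := eq_of_mem p hp q hq (φ v) (hpi ▸ List.getElem_mem hi)
          (List.mem_of_head? hqh)
        subst hpq
        rw [List.head?_eq_getElem?, List.getElem?_eq_getElem (by omega)] at hqh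
        have := (hR p hp).2.getElem_inj_iff.1 (hpi.trans (Option.some.inj hqh).symm)
        omega
      · have := List.isChain_iff_getElem.1 (hR p hp).1.2 i hi
        rwa [hpv, hpi] at this
    · refine ⟨fun hX' => ?_, Or.inl hv''⟩
      obtain ⟨q, hq, hqh⟩ := hX _ hX'
      exact hv' q hq (hv'' ▸ List.mem_of_head? hqh)

theorem iterate_inj_of_injOn_compl {V : Type*} {X T : Set V} {φ : V → V}
    (hinj : Set.InjOn φ Tᶜ) (hφ : ∀ v ∈ Tᶜ, φ v ∉ X) {x y : V} (hx : x ∈ X) (hy : y ∈ X) :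
    ∀ i j : ℕ, (∀ k < i, φ^[k] x ∉ T) → (∀ k < j, φ^[k] y ∉ T) → φ^[i] x = φ^[j] y →
      x = y ∧ i = j
  | 0, 0, _, _, h => ⟨h, rfl⟩
  | 0, j + 1, _, hj, h => by
    rw [Function.iterate_succ_apply'] at h
    exact absurd (h ▸ hx) (hφ _ (hj j j.lt_succ_self))
  | i + 1, 0, hi, _, h => by
    rw [Function.iterate_succ_apply'] at h
    exact absurd (h ▸ hy) (hφ _ (hi i i.lt_succ_self))
  | i + 1, j + 1, hi, hj, h => by
    rw [Function.iterate_succ_apply', Function.iterate_succ_apply'] at h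
    obtain ⟨hxy, hij⟩ := iterate_inj_of_injOn_compl hinj hφ hx hy i j
      (fun k hk => hi k (by omega)) (fun k hk => hj k (by omega))
      (hinj (hi i i.lt_succ_self) (hj j j.lt_succ_self) h)
    exact ⟨hxy, by rw [hij]⟩

/-- The orbits of `X` under a suitable injection of the complement of `T` form a routing
as soon as they all reach `T`. -/
theorem hasRouting_of_injOn {V : Type*} {A : Set (V × V)} {X T : Set V} {φ : V → V}
    (hinj : Set.InjOn φ Tᶜ) (hφ : ∀ v ∈ Tᶜ, φ v ∉ X ∧ (φ v = v ∨ (v, φ v) ∈ A))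
    (hT : ∀ x ∈ X, ∃ n, φ^[n] x ∈ T) : HasRouting A X T := by
  classical
  have hfirst : ∀ x ∈ X, ∃ n, φ^[n] x ∈ T ∧ ∀ k < n, φ^[k] x ∉ T := fun x hx =>
    ⟨Nat.find (hT x hx), Nat.find_spec (hT x hx), fun _ hk => Nat.find_min (hT x hx) hk⟩
  choose! N hNT hNlt using hfirst
  have key : ∀ {x y}, x ∈ X → y ∈ X → ∀ {i j}, i < N x + 1 → j < N y + 1 →
      φ^[i] x = φ^[j] y → x = y ∧ i = j := fun {x y} hx hy {i j} hi hj h =>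
    iterate_inj_of_injOn_compl hinj (fun v hv => (hφ v hv).1) hx hy i j
      (fun k hk => hNlt x hx k (by omega)) (fun k hk => hNlt y hy k (by omega)) h
  refine ⟨(fun x => (List.range (N x + 1)).map fun i => φ^[i] x) '' X, ?_, ?_, ?_, ?_⟩
  · rintro _ ⟨x, hx, rfl⟩
    refine ⟨⟨by simp, ?_⟩, ?_⟩
    · refine List.isChain_iff_getElem.2 fun i hi => ?_
      simp only [List.length_map, List.length_range] at hi
      simp only [List.getElem_map, List.getElem_range]
      have hstep := (hφ _ (hNlt x hx i (by omega))).2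
      rw [← Function.iterate_succ_apply' φ] at hstep
      refine hstep.resolve_left fun h => ?_
      have := (key hx hx hi (by omega) h).2
      omega
    · refine List.Nodup.map_on (fun i hi j hj h => ?_) List.nodup_range
      exact (key hx hx (List.mem_range.1 hi) (List.mem_range.1 hj) h).2
  · exact fun x hx => ⟨_, ⟨x, hx, rfl⟩, by simp [List.range_succ_eq_map]⟩
  · rintro _ ⟨x, hx, rfl⟩
    exact ⟨_, hNT x hx, by simp [List.range_succ]⟩
  · rintro _ ⟨x, hx, rfl⟩ _ ⟨y, hy, rfl⟩
    by_cases hxy : x = y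
    · exact Or.inl (by rw [hxy])
    · refine Or.inr fun v hv hv' => hxy ?_
      obtain ⟨i, hi, rfl⟩ := List.mem_map.1 hv
      obtain ⟨j, hj, hij⟩ := List.mem_map.1 hv'
      exact (key hx hy (List.mem_range.1 hi) (List.mem_range.1 hj) hij.symm).1

theorem hasRouting_iff_exists_injOn {V : Type*} [Finite V] {A : Set (V × V)} {X T : Set V} :
    HasRouting A X T ↔
      ∃ φ : V → V, Set.InjOn φ Tᶜ ∧ ∀ v ∈ Tᶜ, φ v ∉ X ∧ (φ v = v ∨ (v, φ v) ∈ A) := by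
  refine ⟨HasRouting.exists_injOn, fun ⟨φ, hinj, hφ⟩ => hasRouting_of_injOn hinj hφ ?_⟩
  intro x hx
  by_contra! h
  obtain ⟨i, j, hij, heq⟩ := Finite.exists_ne_map_eq_of_infinite fun n : ℕ => φ^[n] x
  exact hij (iterate_inj_of_injOn_compl hinj (fun v hv => (hφ v hv).1) hx hx i j
    (fun k _ => h k) (fun k _ => h k) heq).2

/-- The arcs of the bipartite digraph of a relation between `J` and `V`, directed towards `V`,
where `J` is coded by natural numbers. -/
def relArcs {V J : Type*} (e : J → ℕ) (r : J → V → Prop) : Set ((V ⊕ ℕ) × (V ⊕ ℕ)) :=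
  {a | ∃ s w, r s w ∧ a = (Sum.inr (e s), Sum.inl w)}

theorem not_isCycle_relArcs {V J : Type*} (e : J → ℕ) (r : J → V → Prop) (p : List (V ⊕ ℕ)) :
    ¬ IsCycle (relArcs e r) p := by
  rintro ⟨⟨-, hc⟩, hlen, hends, -⟩
  match p, hc, hlen, hends with
  | [a, b], hc, _, hends =>
    obtain ⟨s, w, -, h⟩ := List.isChain_pair.1 hc
    simp only [Prod.mk.injEq] at h
    obtain ⟨rfl, rfl⟩ := h
    simp at hends
  | a :: b :: c :: l, hc, _, _ =>
    obtain ⟨⟨s, w, -, h⟩, hc⟩ := List.isChain_cons_cons.1 hc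
    obtain ⟨⟨s', w', -, h'⟩, -⟩ := List.isChain_cons_cons.1 hc
    simp only [Prod.mk.injEq] at h h'
    exact Sum.inl_ne_inr (h.2.symm.trans h'.1)

theorem hasRouting_relArcs_iff {V J : Type*} {e : J → ℕ} (he : Function.Injective e)
    {r : J → V → Prop} {X : Set V} :
    HasRouting (relArcs e r) (Sum.inl '' X ∪ Set.range fun s => Sum.inr (e s))
        (Set.range Sum.inl) ↔
      ∃ ψ : J → V, Function.Injective ψ ∧ ∀ s, ψ s ∉ X ∧ r s (ψ s) := by
  constructor
  · intro h
    obtain ⟨φ, hinj, hφ⟩ := h.exists_injOn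
    have hmem : ∀ s, (Sum.inr (e s) : V ⊕ ℕ) ∈ (Set.range (Sum.inl : V → V ⊕ ℕ))ᶜ := by simp
    have hstep : ∀ s, ∃ w, r s w ∧ φ (Sum.inr (e s)) = Sum.inl w := by
      intro s
      obtain ⟨hX, h | ⟨s', w, hr, h⟩⟩ := hφ _ (hmem s)
      · exact absurd (Or.inr ⟨s, h.symm⟩) hX
      · simp only [Prod.mk.injEq, Sum.inr.injEq] at h
        exact ⟨w, he h.1 ▸ hr, h.2⟩
    choose ψ hr hψ using hstep
    refine ⟨ψ, fun s s' h => he (Sum.inr_injective (hinj (hmem s) (hmem s') ?_)), fun s =>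
      ⟨fun hX => (hφ _ (hmem s)).1 (Or.inl ⟨_, hX, (hψ s).symm⟩), hr s⟩⟩
    rw [hψ, hψ, h]
  · rintro ⟨ψ, hinj, hψ⟩
    classical
    let φ : V ⊕ ℕ → V ⊕ ℕ := Sum.elim Sum.inl fun n =>
      if h : ∃ s, e s = n then Sum.inl (ψ h.choose) else Sum.inr n
    have hφe : ∀ s, φ (Sum.inr (e s)) = Sum.inl (ψ s) := by
      intro s
      have h : ∃ s', e s' = e s := ⟨s, rfl⟩
      simp only [φ, Sum.elim_inr, dif_pos h, he h.choose_spec]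
    have hφn : ∀ n, (¬ ∃ s, e s = n) → φ (Sum.inr n) = Sum.inr n := by
      intro n hn
      simp only [φ, Sum.elim_inr, dif_neg hn]
    refine hasRouting_of_injOn (φ := φ) ?_ ?_ ?_
    · rintro (v | n) hn (w | m) hm h
      · simp at hn
      · simp at hn
      · simp at hm
      · by_cases hn' : ∃ s, e s = n <;> by_cases hm' : ∃ s, e s = m
        · obtain ⟨s, rfl⟩ := hn'
          obtain ⟨s', rfl⟩ := hm'
          rw [hφe, hφe] at h
          rw [hinj (Sum.inl_injective h)]
        · obtain ⟨s, rfl⟩ := hn'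
          rw [hφe, hφn m hm'] at h
          cases h
        · obtain ⟨s, rfl⟩ := hm'
          rw [hφe, hφn n hn'] at h
          cases h
        · rwa [hφn n hn', hφn m hm'] at h
    · rintro (v | n) hn
      · simp at hn
      · by_cases hn' : ∃ s, e s = n
        · obtain ⟨s, rfl⟩ := hn'
          rw [hφe]
          exact ⟨by simpa using (hψ s).1, Or.inr ⟨s, ψ s, (hψ s).2, rfl⟩⟩
        · rw [hφn n hn']
          exact ⟨by simpa using hn', Or.inl rfl⟩
    · rintro _ (⟨v, -, rfl⟩ | ⟨s, rfl⟩)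
      · exact ⟨0, v, rfl⟩
      · exact ⟨1, ψ s, (hφe s).symm⟩

/-- Routability as a matching problem: the complement of `T` together with `k` unconstrained
elements has to be matched into the complement of `X`. -/
theorem hasRouting_iff_exists_matching {V : Type*} [Finite V] {A : Set (V × V)} {X T : Set V}
    {k : ℕ} (hX : HasRouting A X T → X.ncard + k ≤ T.ncard) :
    HasRouting A X T ↔ ∃ ψ : ↥Tᶜ ⊕ Fin k → V, Function.Injective ψ ∧ ∀ s, ψ s ∉ X ∧
      Sum.elim (fun v w => w = v.1 ∨ (v.1, w) ∈ A) (fun _ _ => True) s (ψ s) := by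
  classical
  constructor
  · intro h
    obtain ⟨φ, hinj, hφ⟩ := h.exists_injOn
    have hcard : k ≤ (X ∪ φ '' Tᶜ)ᶜ.ncard := by
      have h1 := Set.ncard_add_ncard_compl (X ∪ φ '' Tᶜ)
      have h2 := Set.ncard_union_le X (φ '' Tᶜ)
      have h3 := hinj.ncard_image
      have h4 := Set.ncard_add_ncard_compl T
      have h5 := hX h
      omega
    obtain ⟨f⟩ : Nonempty (Fin k ↪ ↥(X ∪ φ '' Tᶜ)ᶜ) := by
      have := Fintype.ofFinite ↥(X ∪ φ '' Tᶜ)ᶜ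
      refine Function.Embedding.nonempty_of_card_le ?_
      rwa [Fintype.card_fin, ← Nat.card_eq_fintype_card, Nat.card_coe_set_eq]
    refine ⟨Sum.elim (fun v => φ v) fun i => f i, ?_, ?_⟩
    · refine Function.Injective.sumElim (fun u v h => Subtype.ext (hinj u.2 v.2 h))
        (Subtype.val_injective.comp f.injective) fun v i h => (f i).2 ?_
      exact Or.inr ⟨v, v.2, h⟩
    · rintro (v | i)
      · exact hφ v v.2
      · exact ⟨fun h => (f i).2 (Or.inl h), trivial⟩
  · rintro ⟨ψ, hinj, hψ⟩
    refine hasRouting_iff_exists_injOn.2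
      ⟨fun v => if h : v ∈ Tᶜ then ψ (Sum.inl ⟨v, h⟩) else v, ?_, ?_⟩
    · intro u hu v hv h
      simp only [dif_pos hu, dif_pos hv] at h
      exact congrArg Subtype.val (Sum.inl_injective (hinj h))
    · intro v hv
      simp only [dif_pos hv]
      exact hψ (Sum.inl ⟨v, hv⟩)

theorem HasRouting.ncard_le {V : Type*} [Finite V] {A : Set (V × V)} {X T : Set V}
    (h : HasRouting A X T) : X.ncard ≤ T.ncard := by
  obtain ⟨φ, hinj, hφ⟩ := h.exists_injOn
  have h1 := Set.ncard_le_ncard_of_injOn φ (fun v hv => (hφ v hv).1) hinj (t := Xᶜ)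
  have h2 := Set.ncard_add_ncard_compl T
  have h3 := Set.ncard_add_ncard_compl X
  omega

/-- Every gammoid `M = Γ(D₀,T₀,E)` has an acyclic quasi-representation: there are an acyclic
digraph `D` (on fresh vertices `V ⊕ ℕ`) and sets `T, E' ⊇ E` with `M = Γ(D,T,E') . E`
(contracting `E' ∖ E`) and `|T| = rk_M(E) + |E' ∖ E|`; here `B` is a maximal independent set
of `M`, so `rk_M(E) = |B|`. -/
theorem gammoid_acyclic_quasi_representation {V : Type*} [Fintype V]
    (A : Set (V × V)) (T E : Set V)
    (B : Set V) (hB : GammoidIndep A T E B)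
    (hBmax : ∀ I, GammoidIndep A T E I → I.ncard ≤ B.ncard) :
    ∃ (A' : Set ((V ⊕ ℕ) × (V ⊕ ℕ))) (T' E' Vf : Set (V ⊕ ℕ)),
      Vf.Finite ∧ (∀ a ∈ A', a.1 ∈ Vf ∧ a.2 ∈ Vf) ∧ T' ⊆ Vf ∧ E' ⊆ Vf ∧
      (∀ p, ¬ IsCycle A' p) ∧
      Sum.inl '' E ⊆ E' ∧
      (∀ X, X ⊆ E →
        (GammoidIndep A T E X ↔
          ContractIndep (GammoidIndep A' T' E') (E' \ Sum.inl '' E) (Sum.inl '' X))) ∧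
      T'.ncard = B.ncard + (E' \ Sum.inl '' E).ncard := by
  classical
  have hle := hB.2.ncard_le
  obtain ⟨e, he⟩ := Countable.exists_injective_nat (↥Tᶜ ⊕ Fin (T.ncard - B.ncard))
  let C : Set (V ⊕ ℕ) := Set.range fun s => Sum.inr (e s)
  let A' : Set ((V ⊕ ℕ) × (V ⊕ ℕ)) :=
    relArcs e (Sum.elim (fun v w => w = v.1 ∨ (v.1, w) ∈ A) fun _ _ => True)
  have hC : (Sum.inl '' E ∪ C) \ Sum.inl '' E = C :=
    Set.union_sdiff_cancel_left (by rintro _ ⟨⟨v, -, rfl⟩, s, hs⟩; cases hs)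
  have hCfin : C.Finite := Set.finite_range _
  have key : ∀ X ⊆ E, (HasRouting A X T ↔
      HasRouting A' (Sum.inl '' X ∪ C) (Set.range Sum.inl)) := fun X hXE =>
    (hasRouting_iff_exists_matching fun hX => by
      have := hBmax X ⟨hXE, hX⟩
      omega).trans (hasRouting_relArcs_iff he).symm
  refine ⟨A', Set.range Sum.inl, Sum.inl '' E ∪ C, Set.range Sum.inl ∪ C,
    (Set.finite_range _).union hCfin, ?_, Set.subset_union_left,
    Set.union_subset_union_left _ (Set.image_subset_range _ _), not_isCycle_relArcs _ _,
    Set.subset_union_left, fun X hXE => ?_, ?_⟩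
  · rintro _ ⟨s, w, -, rfl⟩
    exact ⟨Or.inr ⟨s, rfl⟩, Or.inl ⟨w, rfl⟩⟩
  · rw [hC]
    constructor
    · intro hX
      have hX' := (key X hXE).1 hX.2
      exact ⟨C, subset_rfl, ⟨Set.subset_union_right, hX'.mono Set.subset_union_right⟩,
        fun J hCJ hJC _ => hJC.antisymm hCJ,
        Set.union_subset_union_left _ (Set.image_mono hXE), hX'⟩
    · rintro ⟨I, hIC, -, hmax, -, hXI⟩
      have hCI := hmax C hIC subset_rfl
        ⟨Set.subset_union_right, ((key B hB.1).1 hB.2).mono Set.subset_union_right⟩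
      exact ⟨hXE, (key X hXE).2 (hCI ▸ hXI)⟩
  · have h1 := Set.ncard_add_ncard_compl T
    have h2 : C.ncard = Tᶜ.ncard + (T.ncard - B.ncard) := by
      refine (Nat.card_range_of_injective (Sum.inr_injective.comp he)).trans ?_
      rw [Nat.card_sum, Nat.card_coe_set_eq, Nat.card_fin]
    have h3 : (Set.range (Sum.inl : V → V ⊕ ℕ)).ncard = Nat.card V := by
      rw [← Nat.card_coe_set_eq, Nat.card_range_of_injective Sum.inl_injective]
    rw [hC]
    omega
end

section
/- Let D = (V,A) be a digraph, T, E ⊆ V, and C a circuit of the gammoid Γ(D,T,E). Then the minimum cardinality of a C-T-separator in D equals |C| - 1; in particular, for every c ∈ C there is a routing C\{c} ⇉ T in D, and there exists a C-T-separator S ⊆ V with |S| = |C| - 1 such that every routing from a subset of C to T of cardinality |C|-1 meets every vertex of S. -/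
/-- An `S'`-`T'`-separator: a set of vertices met by every path from `S'` to `T'`. -/
def IsSeparator {V : Type*} (A : Set (V × V)) (S' T' S : Set V) : Prop :=
  ∀ p, IsPath A p → ∀ x, p.head? = some x → x ∈ S' →
    ∀ y, p.getLast? = some y → y ∈ T' → ∃ v ∈ S, v ∈ p

/-- `p` is a walk from `u` to `v`. -/
def IsWalkFromTo {V : Type*} (A : Set (V × V)) (u v : V) (p : List V) : Prop :=
  p.IsChain (fun a b => (a, b) ∈ A) ∧ p.head? = some u ∧ p.getLast? = some v

namespace IsWalkFromTo

variable {V : Type*} {A B : Set (V × V)} {u v w x y : V} {p q : List V}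

theorem isWalk (h : IsWalkFromTo A u v p) : IsWalk A p :=
  ⟨by rintro rfl; simp [IsWalkFromTo] at h, h.1⟩

theorem of_isPath (h : IsPath A p) (hu : p.head? = some u) (hv : p.getLast? = some v) :
    IsWalkFromTo A u v p :=
  ⟨h.1.2, hu, hv⟩

theorem singleton (A : Set (V × V)) (u : V) : IsWalkFromTo A u u [u] := by
  simp [IsWalkFromTo]

theorem cons (h : (w, u) ∈ A) (hp : IsWalkFromTo A u v p) : IsWalkFromTo A w v (w :: p) := by
  obtain ⟨h1, h2, h3⟩ := hp
  cases p with
  | nil => simp at h2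
  | cons a l => simp_all [IsWalkFromTo]

theorem append (h : (v, x) ∈ A) (hp : IsWalkFromTo A u v p) (hq : IsWalkFromTo A x y q) :
    IsWalkFromTo A u y (p ++ q) := by
  obtain ⟨h1, h2, h3⟩ := hp
  obtain ⟨h4, h5, h6⟩ := hq
  refine ⟨?_, by simp [h2], by simp [h6]⟩
  rw [List.isChain_append]
  refine ⟨h1, h4, ?_⟩
  simp_all

theorem mono (hp : IsWalkFromTo A u v p)
    (h : ∀ a ∈ p, ∀ b ∈ p.tail, (a, b) ∈ A → (a, b) ∈ B) : IsWalkFromTo B u v p :=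
  ⟨hp.1.imp_of_mem_tail_imp fun a b ha hb => h a ha b hb, hp.2⟩

theorem split (hp : IsWalkFromTo A u v (p ++ w :: q)) :
    IsWalkFromTo A u w (p ++ [w]) ∧ IsWalkFromTo A w v (w :: q) := by
  obtain ⟨h1, h2, h3⟩ := hp
  rw [List.isChain_split] at h1
  refine ⟨⟨h1.1, ?_, by simp⟩, h1.2, by simp, by simpa using h3⟩
  cases p <;> simp_all

@[elab_as_elim]
theorem cons_induction {motive : ∀ u p, IsWalkFromTo A u v p → Prop}
    (single : motive v [v] (singleton A v))
    (step : ∀ a b l (hab : (a, b) ∈ A) (hl : IsWalkFromTo A b v l), motive b l hl →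
      motive a (a :: l) (hl.cons hab))
    (hp : IsWalkFromTo A u v p) : motive u p hp := by
  induction p generalizing u with
  | nil => simp [IsWalkFromTo] at hp
  | cons a l ih =>
    obtain ⟨h1, h2, h3⟩ := id hp
    obtain rfl : a = u := by simpa using h2
    cases l with
    | nil =>
      obtain rfl : a = v := by simpa using h3
      exact single
    | cons b l =>
      rw [List.isChain_cons_cons] at h1
      have hb : IsWalkFromTo A b v (b :: l) := ⟨h1.2, by simp, by simpa using h3⟩
      exact step a b _ h1.1 hb (ih hb)

theorem trans (hp : IsWalkFromTo A u v p) (hq : IsWalkFromTo A v w q) :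
    ∃ r, IsWalkFromTo A u w r ∧ ∀ z ∈ r, z ∈ p ∨ z ∈ q := by
  induction hp using cons_induction with
  | single => exact ⟨q, hq, fun z hz => Or.inr hz⟩
  | step a b l hab hl ih =>
    obtain ⟨r, hr, hs⟩ := ih
    refine ⟨a :: r, hr.cons hab, ?_⟩
    simp only [List.mem_cons]
    rintro z (rfl | hz)
    · simp
    · rcases hs z hz with h | h <;> simp [h]

theorem exists_isPath (hp : IsWalkFromTo A u v p) :
    ∃ q, IsPath A q ∧ q.head? = some u ∧ q.getLast? = some v ∧ ∀ z ∈ q, z ∈ p := by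
  induction hp using cons_induction with
  | single => exact ⟨[v], ⟨(singleton A v).isWalk, by simp⟩, by simp⟩
  | step a b l hab hl ih =>
    obtain ⟨q, hq, hb, hv, hs⟩ := ih
    by_cases ha : a ∈ q
    · obtain ⟨s, t, rfl⟩ := List.append_of_mem ha
      have h := (of_isPath hq hb hv).split.2
      refine ⟨a :: t, ⟨h.isWalk, ?_⟩, h.2.1, h.2.2, ?_⟩
      · exact hq.2.sublist (List.sublist_append_right _ _)
      · intro z hz
        exact List.mem_cons_of_mem _ (hs z (List.mem_append_right _ hz))
    · have h := (of_isPath hq hb hv).cons hab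
      refine ⟨a :: q, ⟨h.isWalk, List.nodup_cons.2 ⟨ha, hq.2⟩⟩, h.2.1, h.2.2, ?_⟩
      simp only [List.mem_cons]
      rintro z (rfl | hz)
      · simp
      · simp [hs z hz]

/-- The initial segment of a walk up to its first vertex in a set containing `x` avoids
the arc `(x, y)`. -/
theorem exists_initial {W : Set V} (hx : x ∈ W) (y : V) (hp : IsWalkFromTo A u v p)
    (hW : ∃ z ∈ W, z ∈ p) :
    ∃ w ∈ W, ∃ q, IsWalkFromTo (A \ {(x, y)}) u w q ∧ ∀ z ∈ q, z ∈ p := by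
  induction hp using cons_induction with
  | single => exact ⟨v, by simpa using hW, [v], singleton _ v, by simp⟩
  | step a b l hab hl ih =>
    by_cases ha : a ∈ W
    · exact ⟨a, ha, [a], singleton _ a, by simp⟩
    · obtain ⟨z, hz, hzp⟩ := hW
      have hzl : z ∈ l := by
        rcases List.mem_cons.1 hzp with rfl | h
        · exact absurd hz ha
        · exact h
      obtain ⟨w, hw, q, hq, hs⟩ := ih ⟨z, hz, hzl⟩
      refine ⟨w, hw, a :: q, hq.cons ⟨hab, ?_⟩, ?_⟩
      · rintro h
        obtain ⟨rfl, -⟩ := Prod.mk.inj h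
        exact ha hx
      · simp only [List.mem_cons]
        rintro z (rfl | hz)
        · simp
        · simp [hs z hz]

/-- The final segment of a walk from its last vertex in a set containing `y` avoids
the arc `(x, y)`. -/
theorem exists_final {W : Set V} (x : V) (hy : y ∈ W) (hp : IsWalkFromTo A u v p)
    (hW : ∃ z ∈ W, z ∈ p) :
    ∃ w ∈ W, ∃ q, IsWalkFromTo (A \ {(x, y)}) w v q ∧ ∀ z ∈ q, z ∈ p := by
  induction hp using cons_induction with
  | single => exact ⟨v, by simpa using hW, [v], singleton _ v, by simp⟩
  | step a b l hab hl ih =>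
    by_cases hWl : ∃ z ∈ W, z ∈ l
    · obtain ⟨w, hw, q, hq, hs⟩ := ih hWl
      exact ⟨w, hw, q, hq, fun z hz => List.mem_cons_of_mem _ (hs z hz)⟩
    · obtain ⟨z, hz, hzp⟩ := hW
      have ha : a ∈ W := by
        rcases List.mem_cons.1 hzp with rfl | h
        · exact hz
        · exact absurd ⟨z, hz, h⟩ hWl
      refine ⟨a, ha, a :: l, (hl.cons hab).mono fun c _ d hd h => ⟨h, ?_⟩, fun z hz => hz⟩
      rintro h'
      obtain ⟨-, rfl⟩ := Prod.mk.inj h'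
      exact hWl ⟨d, hy, hd⟩

end IsWalkFromTo

theorem IsSeparator.exists_mem {V : Type*} {A : Set (V × V)} {X Y S : Set V}
    (hS : IsSeparator A X Y S) {u v : V} {p : List V} (hp : IsWalkFromTo A u v p)
    (hu : u ∈ X) (hv : v ∈ Y) : ∃ z ∈ S, z ∈ p := by
  obtain ⟨q, hq, hqu, hqv, hs⟩ := hp.exists_isPath
  obtain ⟨z, hz, hzq⟩ := hS q hq u hqu hu v hqv hv
  exact ⟨z, hz, hs z hzq⟩

theorem IsSeparator.insert_left {V : Type*} {A : Set (V × V)} {X Y S : Set V} {x y : V}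
    (hS : IsSeparator (A \ {(x, y)}) X Y S) : IsSeparator A X Y (insert x S) := by
  intro p hp u hu huX v hv hvY
  by_cases hx : x ∈ p
  · exact ⟨x, by simp, hx⟩
  · have h : IsWalkFromTo (A \ {(x, y)}) u v p :=
      (IsWalkFromTo.of_isPath hp hu hv).mono fun a ha b _ hab => ⟨hab, by
        rintro h
        obtain ⟨rfl, -⟩ := Prod.mk.inj h
        exact hx ha⟩
    obtain ⟨z, hz, hzp⟩ := hS.exists_mem h huX hvY
    exact ⟨z, Set.mem_insert_of_mem _ hz, hzp⟩

theorem IsSeparator.insert_right {V : Type*} {A : Set (V × V)} {X Y S : Set V} {x y : V}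
    (hS : IsSeparator (A \ {(x, y)}) X Y S) : IsSeparator A X Y (insert y S) := by
  intro p hp u hu huX v hv hvY
  by_cases hy : y ∈ p
  · exact ⟨y, by simp, hy⟩
  · have h : IsWalkFromTo (A \ {(x, y)}) u v p :=
      (IsWalkFromTo.of_isPath hp hu hv).mono fun a _ b hb hab => ⟨hab, by
        rintro h
        obtain ⟨-, rfl⟩ := Prod.mk.inj h
        exact hy (List.mem_of_mem_tail hb)⟩
    obtain ⟨z, hz, hzp⟩ := hS.exists_mem h huX hvY
    exact ⟨z, Set.mem_insert_of_mem _ hz, hzp⟩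

/-- A family of `k` pairwise vertex-disjoint paths `f i` from `a i ∈ X` to `b i ∈ Y`. -/
structure IsLinkage {V : Type*} (A : Set (V × V)) (X Y : Set V) {k : ℕ}
    (f : Fin k → List V) (a b : Fin k → V) : Prop where
  isPath : ∀ i, IsPath A (f i)
  head : ∀ i, (f i).head? = some (a i)
  last : ∀ i, (f i).getLast? = some (b i)
  head_mem : ∀ i, a i ∈ X
  last_mem : ∀ i, b i ∈ Y
  disjoint : ∀ i j v, v ∈ f i → v ∈ f j → i = j

namespace IsLinkage

variable {V : Type*} {A : Set (V × V)} {X Y : Set V} {k : ℕ} {f : Fin k → List V}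
  {a b : Fin k → V}

theorem walk (h : IsLinkage A X Y f a b) (i : Fin k) : IsWalkFromTo A (a i) (b i) (f i) :=
  .of_isPath (h.isPath i) (h.head i) (h.last i)

theorem head_mem_path (h : IsLinkage A X Y f a b) (i : Fin k) : a i ∈ f i :=
  List.mem_of_mem_head? (h.head i)

theorem last_mem_path (h : IsLinkage A X Y f a b) (i : Fin k) : b i ∈ f i :=
  List.mem_of_mem_getLast? (h.last i)

theorem head_injective (h : IsLinkage A X Y f a b) : Function.Injective a := fun i j hij =>
  h.disjoint i j (a i) (h.head_mem_path i) (hij ▸ h.head_mem_path j)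

theorem last_injective (h : IsLinkage A X Y f a b) : Function.Injective b := fun i j hij =>
  h.disjoint i j (b i) (h.last_mem_path i) (hij ▸ h.last_mem_path j)

theorem exists_of_walks {g : Fin k → List V} (hg : ∀ i, IsWalkFromTo A (a i) (b i) (g i))
    (ha : ∀ i, a i ∈ X) (hb : ∀ i, b i ∈ Y) (hd : ∀ i j v, v ∈ g i → v ∈ g j → i = j) :
    ∃ f : Fin k → List V, IsLinkage A X Y f a b := by
  choose f hf hfa hfb hs using fun i => (hg i).exists_isPath
  exact ⟨f, hf, hfa, hfb, ha, hb, fun i j v hi hj => hd i j v (hs i v hi) (hs j v hj)⟩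

end IsLinkage

theorem Set.exists_eq_of_injective_of_ncard_le {V : Type*} [Finite V] {W : Set V} {k : ℕ}
    {a : Fin k → V} (ha : Function.Injective a) (hW : ∀ i, a i ∈ W) (hk : W.ncard ≤ k) {w : V}
    (hw : w ∈ W) : ∃ i, a i = w := by
  have hr : Set.range a = W := by
    refine Set.eq_of_subset_of_ncard_le (Set.range_subset_iff.2 hW) ?_ (Set.toFinite _)
    rw [Set.ncard_range_of_injective ha]
    simpa using hk
  rw [← hr] at hw
  exact hw

/-- Two linkages in `D - (x, y)` on either side of a separator `S` of `D - (x, y)`, one ending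
in `S ∪ {x}` and one starting in `S ∪ {y}`, can be joined using the arc `(x, y)`. -/
theorem exists_linkage_of_separator {V : Type*} [Finite V] {A : Set (V × V)} {X Y S : Set V}
    {x y : V} {k : ℕ} (hxy : (x, y) ∈ A) (hS : IsSeparator (A \ {(x, y)}) X Y S)
    (hy : y ∉ S)
    (hxk : (insert x S).ncard ≤ k) (hyk : (insert y S).ncard ≤ k)
    {f g : Fin k → List V} {a b c d : Fin k → V}
    (hf : IsLinkage (A \ {(x, y)}) X (insert x S) f a b)
    (hg : IsLinkage (A \ {(x, y)}) (insert y S) Y g c d) :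
    ∃ (h : Fin k → List V) (a b : Fin k → V), IsLinkage A X Y h a b := by
  have hsub : A \ {(x, y)} ⊆ A := Set.sdiff_subset
  have hbS : ∀ i v, v ∈ f i → v ∈ S → v = b i := by
    intro i v hv hvS
    obtain ⟨j, rfl⟩ := Set.exists_eq_of_injective_of_ncard_le hf.last_injective hf.last_mem hxk
      (Set.mem_insert_of_mem x hvS)
    rw [hf.disjoint i j _ hv (hf.last_mem_path j)]
  have hcS : ∀ i v, v ∈ g i → v ∈ S → v = c i := by
    intro i v hv hvS
    obtain ⟨j, rfl⟩ := Set.exists_eq_of_injective_of_ncard_le hg.head_injective hg.head_mem hyk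
      (Set.mem_insert_of_mem y hvS)
    rw [hg.disjoint i j _ hv (hg.head_mem_path j)]
  have cross : ∀ i j v, v ∈ f i → v ∈ g j → v ∈ S := by
    intro i j v hvf hvg
    obtain ⟨p₁, p₂, hp⟩ := List.append_of_mem hvf
    obtain ⟨q₁, q₂, hq⟩ := List.append_of_mem hvg
    have hpw := hf.walk i
    have hqw := hg.walk j
    rw [hp] at hpw
    rw [hq] at hqw
    obtain ⟨r, hr, hrs⟩ := hpw.split.1.trans hqw.split.2
    obtain ⟨z, hz, hzr⟩ := hS.exists_mem hr (hf.head_mem i) (hg.last_mem j)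
    rcases hrs z hzr with h | h
    · have hzb := hbS i z (by rw [hp]; simp at h ⊢; tauto) hz
      rcases List.mem_append.1 h with h | h
      · have hlast : z ∈ v :: p₂ := by
          have := hpw.split.2.2.2
          rw [hzb]
          exact List.mem_of_mem_getLast? this
        have hnd := (hf.isPath i).2
        rw [hp, List.nodup_append] at hnd
        exact absurd rfl (hnd.2.2 z h z hlast)
      · rwa [← List.mem_singleton.1 h]
    · have hzc := hcS j z (by rw [hq]; exact List.mem_append_right _ h) hz
      rcases List.mem_cons.1 h with h | h
      · rwa [← h]
      · have hhead : z ∈ q₁ ++ [v] := by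
          have := hqw.split.1.2.1
          rw [hzc]
          exact List.mem_of_mem_head? this
        have hnd := (hg.isPath j).2
        rw [hq, List.append_cons, List.nodup_append] at hnd
        exact absurd rfl (hnd.2.2 z hhead z h)
  have glue : ∀ i, ∃ j h, IsWalkFromTo A (a i) (d j) h ∧ (∀ v ∈ h, v ∈ f i ∨ v ∈ g j) ∧
      (c j = b i ∨ b i = x ∧ c j = y) := by
    intro i
    have hfi := (hf.walk i).mono fun a _ b _ h => hsub h
    rcases hf.last_mem i with hi | hi
    · obtain ⟨j, hj⟩ := Set.exists_eq_of_injective_of_ncard_le hg.head_injective hg.head_mem hyk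
        (Set.mem_insert y S)
      have hgj := (hg.walk j).mono fun a _ b _ h => hsub h
      refine ⟨j, f i ++ g j, hfi.append ?_ hgj, by simp, .inr ⟨hi, hj⟩⟩
      rwa [hi, hj]
    · obtain ⟨j, hj⟩ := Set.exists_eq_of_injective_of_ncard_le hg.head_injective hg.head_mem hyk
        (Set.mem_insert_of_mem y hi)
      have hgj := (hg.walk j).mono fun a _ b _ h => hsub h
      rw [hj] at hgj
      obtain ⟨h, hh, hs⟩ := hfi.trans hgj
      exact ⟨j, h, hh, hs, .inl hj⟩
  choose φ h hw hmem hφ using glue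
  have hcross : ∀ i j v, v ∈ f i → v ∈ g (φ j) → i = j := by
    intro i j v hvf hvg
    have hvS := cross i (φ j) v hvf hvg
    have h1 := hbS i v hvf hvS
    have h2 := hcS (φ j) v hvg hvS
    rcases hφ j with h3 | ⟨-, h3⟩
    · exact hf.last_injective (by rw [← h1, h2, h3])
    · exact absurd (h3 ▸ h2 ▸ hvS) hy
  have hφinj : ∀ i j, φ i = φ j → i = j := by
    intro i j hij
    apply hf.last_injective
    have hi := hf.last_mem i
    have hj := hf.last_mem j
    have h1 := hφ i
    have h2 := hφ j
    rw [hij] at h1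
    rcases h1 with h1 | ⟨h1, h1'⟩ <;> rcases h2 with h2 | ⟨h2, h2'⟩
    · rw [← h1, h2]
    · rcases hi with hi | hi
      · rw [hi, h2]
      · exact absurd (h2' ▸ h1 ▸ hi) hy
    · rcases hj with hj | hj
      · rw [hj, h1]
      · exact absurd (h1' ▸ h2 ▸ hj) hy
    · rw [h1, h2]
  obtain ⟨h', hh'⟩ := IsLinkage.exists_of_walks hw hf.head_mem (fun i => hg.last_mem (φ i))
    (fun i j v hi hj => by
      rcases hmem i v hi with h1 | h1 <;> rcases hmem j v hj with h2 | h2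
      · exact hf.disjoint i j v h1 h2
      · exact hcross i j v h1 h2
      · exact (hcross j i v h2 h1).symm
      · exact hφinj i j (hg.disjoint _ _ v h1 h2))
  exact ⟨h', _, _, hh'⟩

/-- Menger's theorem for finite digraphs. -/
theorem exists_linkage_of_le_ncard_separator {V : Type*} [Finite V] (A : Set (V × V))
    (X Y : Set V) (k : ℕ) (h : ∀ S, IsSeparator A X Y S → k ≤ S.ncard) :
    ∃ (f : Fin k → List V) (a b : Fin k → V), IsLinkage A X Y f a b := by
  induction hn : A.ncard using Nat.strong_induction_on generalizing A X Y with
  | _ n ih =>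
  rcases A.eq_empty_or_nonempty with rfl | ⟨⟨x, y⟩, hxy⟩
  · have hsep : IsSeparator (∅ : Set (V × V)) X Y (X ∩ Y) := by
      intro p hp u hu huX v hv hvY
      have hw := IsWalkFromTo.of_isPath hp hu hv
      induction hw using IsWalkFromTo.cons_induction with
      | single => exact ⟨v, ⟨huX, hvY⟩, by simp⟩
      | step a b l hab => exact absurd hab (Set.notMem_empty _)
    obtain ⟨e⟩ : Nonempty (Fin k ↪ ↥(X ∩ Y)) := by
      have := Fintype.ofFinite ↥(X ∩ Y)
      apply Function.Embedding.nonempty_of_card_le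
      rw [Fintype.card_fin, ← Nat.card_eq_fintype_card]
      exact h _ hsep
    refine ⟨fun i => [(e i : V)], fun i => e i, fun i => e i,
      fun i => ⟨(IsWalkFromTo.singleton _ _).isWalk, by simp⟩, by simp, by simp,
      fun i => (e i).2.1, fun i => (e i).2.2, ?_⟩
    intro i j v hi hj
    rw [List.mem_singleton] at hi hj
    exact e.injective (Subtype.ext (hi ▸ hj))
  · have hlt : (A \ {(x, y)}).ncard < n :=
      hn ▸ Set.ncard_sdiff_singleton_lt_of_mem hxy (Set.toFinite _)
    by_cases hk : ∀ S, IsSeparator (A \ {(x, y)}) X Y S → k ≤ S.ncard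
    · obtain ⟨f, a, b, hf⟩ := ih _ hlt _ X Y hk rfl
      exact IsLinkage.exists_of_walks (fun i => (hf.walk i).mono fun a _ b _ h => h.1)
        hf.head_mem hf.last_mem hf.disjoint |>.imp fun g hg => ⟨a, b, hg⟩
    · push Not at hk
      obtain ⟨S, hS, hSk⟩ := hk
      have hxS := h _ hS.insert_left
      have hyS := h _ hS.insert_right
      have hy : y ∉ S := fun hy => by rw [Set.insert_eq_of_mem hy] at hyS; omega
      obtain ⟨f, a, b, hf⟩ := ih _ hlt _ X (insert x S) (fun Z hZ => h Z (by
        intro p hp u hu huX v hv hvY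
        have hw := IsWalkFromTo.of_isPath hp hu hv
        obtain ⟨w, hw, q, hq, hs⟩ := hw.exists_initial (Set.mem_insert x S) y
          (hS.insert_left.exists_mem hw huX hvY)
        obtain ⟨z, hz, hzq⟩ := hZ.exists_mem hq huX hw
        exact ⟨z, hz, hs z hzq⟩)) rfl
      obtain ⟨g, c, d, hg⟩ := ih _ hlt _ (insert y S) Y (fun Z hZ => h Z (by
        intro p hp u hu huX v hv hvY
        have hw := IsWalkFromTo.of_isPath hp hu hv
        obtain ⟨w, hw, q, hq, hs⟩ := hw.exists_final x (Set.mem_insert y S)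
          (hS.insert_right.exists_mem hw huX hvY)
        obtain ⟨z, hz, hzq⟩ := hZ.exists_mem hq hw hvY
        exact ⟨z, hz, hs z hzq⟩)) rfl
      have hxk := Set.ncard_insert_le x S
      have hyk := Set.ncard_insert_le y S
      exact exists_linkage_of_separator hxy hS hy (by omega) (by omega) hf hg

theorem IsLinkage.isRouting {V : Type*} {A : Set (V × V)} {X Y : Set V} {k : ℕ}
    {f : Fin k → List V} {a b : Fin k → V} (h : IsLinkage A X Y f a b) :
    IsRouting A (Set.range f) (Set.range a) Y := by
  refine ⟨?_, ?_, ?_, ?_⟩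
  · rintro _ ⟨i, rfl⟩
    exact h.isPath i
  · rintro _ ⟨i, rfl⟩
    exact ⟨_, ⟨i, rfl⟩, h.head i⟩
  · rintro _ ⟨i, rfl⟩
    exact ⟨b i, h.last_mem i, h.last i⟩
  · rintro _ ⟨i, rfl⟩ _ ⟨j, rfl⟩
    by_cases hij : i = j
    · exact .inl (by rw [hij])
    · exact .inr fun v hi hj => hij (h.disjoint i j v hi hj)

theorem exists_separator_ncard_lt_of_not_hasRouting {V : Type*} [Finite V] {A : Set (V × V)}
    {X Y : Set V} (h : ¬HasRouting A X Y) : ∃ S, IsSeparator A X Y S ∧ S.ncard < X.ncard := by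
  by_contra! hS
  obtain ⟨f, a, b, hf⟩ := exists_linkage_of_le_ncard_separator A X Y X.ncard hS
  have hX : X ⊆ Set.range a := fun x hx =>
    Set.exists_eq_of_injective_of_ncard_le hf.head_injective hf.head_mem le_rfl hx
  have hR := hf.isRouting
  exact h ⟨_, hR.1, fun x hx => hR.2.1 x (hX hx), hR.2.2⟩

/-- A routing picks distinct vertices of a separator, one on each path. -/
theorem IsRouting.exists_injOn_separator {V : Type*} {A : Set (V × V)} {R : Set (List V)}
    {C X Y S : Set V} (hR : IsRouting A R X Y) (hXC : X ⊆ C) (hS : IsSeparator A C Y S) :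
    ∃ s : V → V, Set.MapsTo s X S ∧ Set.InjOn s X ∧ ∀ x ∈ X, ∃ p ∈ R, s x ∈ p := by
  have key : ∀ x, ∃ v, x ∈ X → v ∈ S ∧ ∃ p ∈ R, p.head? = some x ∧ v ∈ p := by
    intro x
    by_cases hx : x ∈ X
    · obtain ⟨p, hp, hpx⟩ := hR.2.1 x hx
      obtain ⟨y, hy, hpy⟩ := hR.2.2.1 p hp
      obtain ⟨v, hv, hvp⟩ := hS p (hR.1 p hp) x hpx (hXC hx) y hpy hy
      exact ⟨v, fun _ => ⟨hv, p, hp, hpx, hvp⟩⟩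
    · exact ⟨x, fun h => absurd h hx⟩
  choose s hs using key
  refine ⟨s, fun x hx => (hs x hx).1, ?_, ?_⟩
  · intro x hx x' hx' he
    obtain ⟨-, p, hp, hpx, hvp⟩ := hs x hx
    obtain ⟨-, q, hq, hqx, hvq⟩ := hs x' hx'
    rcases hR.2.2.2 p hp q hq with rfl | hd
    · exact Option.some.inj (hpx.symm.trans hqx)
    · exact absurd (he ▸ hvq) (hd _ hvp)
  · intro x hx
    obtain ⟨-, p, hp, -, hvp⟩ := hs x hx
    exact ⟨p, hp, hvp⟩

theorem IsRouting.ncard_le_separator {V : Type*} [Finite V] {A : Set (V × V)} {R : Set (List V)}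
    {C X Y S : Set V} (hR : IsRouting A R X Y) (hXC : X ⊆ C) (hS : IsSeparator A C Y S) :
    X.ncard ≤ S.ncard := by
  obtain ⟨s, hm, hi, -⟩ := hR.exists_injOn_separator hXC hS
  exact Set.ncard_le_ncard_of_injOn s hm hi (Set.toFinite _)

theorem IsRouting.exists_mem_of_mem_separator {V : Type*} [Finite V] {A : Set (V × V)}
    {R : Set (List V)} {C X Y S : Set V} (hR : IsRouting A R X Y) (hXC : X ⊆ C)
    (hS : IsSeparator A C Y S) (hc : S.ncard ≤ X.ncard) {v : V} (hv : v ∈ S) :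
    ∃ p ∈ R, v ∈ p := by
  obtain ⟨s, hm, hi, hp⟩ := hR.exists_injOn_separator hXC hS
  have him : s '' X = S :=
    Set.eq_of_subset_of_ncard_le hm.image_subset (by rwa [hi.ncard_image])
      (Set.toFinite _)
  rw [← him] at hv
  obtain ⟨x, hx, rfl⟩ := hv
  exact hp x hx

/-- For a circuit `C` of `Γ(D,T,E)`: the minimum size of a `C`-`T`-separator is `|C| − 1`;
every `C∖{c}` admits a routing to `T`; and there is a minimum separator `S` met in every
vertex by every routing from an `(|C|−1)`-element subset of `C` to `T`. -/
theorem circuit_menger_separator {V : Type*} [Fintype V] (A : Set (V × V)) (T E : Set V)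
    (C : Set V) (hC : GammoidCircuit A T E C) :
    (∃ S, IsSeparator A C T S ∧ S.ncard = C.ncard - 1) ∧
    (∀ S, IsSeparator A C T S → C.ncard - 1 ≤ S.ncard) ∧
    (∀ c ∈ C, HasRouting A (C \ {c}) T) ∧
    (∃ S, IsSeparator A C T S ∧ S.ncard = C.ncard - 1 ∧
      ∀ R X, X ⊆ C → X.ncard = C.ncard - 1 → IsRouting A R X T →
        ∀ v ∈ S, ∃ p ∈ R, v ∈ p) := by
  obtain ⟨-, hdep, hmin⟩ := hC
  have hrout : ∀ c ∈ C, HasRouting A (C \ {c}) T := fun c hc =>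
    hmin _ (Set.sdiff_singleton_ssubset.2 hc)
  obtain ⟨c, hc⟩ : C.Nonempty := by
    rw [Set.nonempty_iff_ne_empty]
    rintro rfl
    exact hdep ⟨∅, by simp [IsRouting]⟩
  have hlower : ∀ S, IsSeparator A C T S → C.ncard - 1 ≤ S.ncard := by
    intro S hS
    obtain ⟨R, hR⟩ := hrout c hc
    rw [← Set.ncard_sdiff_singleton_of_mem hc]
    exact hR.ncard_le_separator Set.sdiff_subset hS
  obtain ⟨S, hS, hlt⟩ := exists_separator_ncard_lt_of_not_hasRouting hdep
  have hcard : S.ncard = C.ncard - 1 := by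
    have := hlower S hS
    omega
  refine ⟨⟨S, hS, hcard⟩, hlower, hrout, S, hS, hcard, fun R X hXC hX hR v hv => ?_⟩
  exact hR.exists_mem_of_mem_separator hXC hS (by omega) hv
end
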